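/- Let p = p₁ + p₂ with p₁, p₂ ≥ 1, let Σ be a real symmetric positive definite p × p matrix partitioned into blocks Σ₁₁ (p₁ × p₁), Σ₁₂, Σ₂₁ = Σ₁₂ᵀ, Σ₂₂ (p₂ × p₂) with Σ₁₂ ≠ 0, and let α > 0 be a real number such that 2α is a positive integer or 2α > ⌊(p−1)/2⌋. Let μ be a probability measure on ℝ^p supported on [0,∞)^p whose Laplace transform satisfies ∫ exp(−∑_{j=1}^p t_j x_j) dμ(x) = det(I_p + Σ·diag(t))^{−α} for all t ∈ ℝ^p with nonnegative coordinates, and let μ₁ and μ₂ be the pushforwards of μ under the projections onto the first p₁ and the last p₂ coordinates respectively. Then for all x₁,…,x_p > 0: μ(∏_{j=1}^p [0, x_j]) > μ₁(∏_{j=1}^{p₁} [0, x_j]) · μ₂(∏_{j=p₁+1}^{p} [0, x_j]). -/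

import Mathlib

open MeasureTheory Matrix

/-- A function on the cube `[0, 1]^ι` that is nonnegative against every finite signed combination
of point evaluations which is nonnegative on all monomials; these are the functions given by power
series with nonnegative coefficients, and their limits. -/
def AbsMono {ι : Type} [Fintype ι] (f : (ι → ℝ) → ℝ) : Prop :=
  ∀ (κ : Type) [Fintype κ] (w : κ → ℝ) (z : κ → ι → ℝ), (∀ k i, z k i ∈ Set.Icc (0 : ℝ) 1) →
    (∀ n : ι → ℕ, 0 ≤ ∑ k, w k * ∏ i, z k i ^ n i) → 0 ≤ ∑ k, w k * f (z k)

namespace AbsMono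

variable {ι ι' : Type} [Fintype ι] [Fintype ι']

theorem congr {f g : (ι → ℝ) → ℝ} (hf : AbsMono f)
    (h : ∀ z, (∀ i, z i ∈ Set.Icc (0 : ℝ) 1) → g z = f z) : AbsMono g := by
  intro κ _ w z hz hn
  have := hf κ w z hz hn
  rwa [Finset.sum_congr rfl fun k _ => by rw [h (z k) (hz k)]]

theorem const_mul {f : (ι → ℝ) → ℝ} (hf : AbsMono f) {c : ℝ} (hc : 0 ≤ c) :
    AbsMono fun z => c * f z := by
  intro κ _ w z hz hn
  have := mul_nonneg hc (hf κ w z hz hn)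
  rw [Finset.mul_sum] at this
  exact this.trans_eq (Finset.sum_congr rfl fun k _ => by ring)

theorem one : AbsMono fun _ : ι → ℝ => 1 := by
  intro κ _ w z _ hn
  simpa using hn 0

theorem reindex {f : (ι' → ℝ) → ℝ} (hf : AbsMono f) (e : ι' ≃ ι) :
    AbsMono fun z : ι → ℝ => f (z ∘ e) := by
  intro κ _ w z hz hn
  refine hf κ w (fun k => z k ∘ e) (fun k i => hz k (e i)) fun n => ?_
  refine (hn (n ∘ e.symm)).trans_eq (Finset.sum_congr rfl fun k _ => ?_)
  rw [← e.prod_comp]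
  simp

theorem exp_mul {f : (ι → ℝ) → ℝ} (hf : AbsMono f) {y : ℝ} (hy : 0 ≤ y) :
    AbsMono fun z : Unit ⊕ ι → ℝ => Real.exp (y * z (Sum.inl ())) * f (z ∘ Sum.inr) := by
  intro κ _ w z hz hn
  have key : HasSum (fun m : ℕ => ∑ k, w k * ((y * z k (Sum.inl ())) ^ m / m.factorial *
      f (z k ∘ Sum.inr))) (∑ k, w k * (Real.exp (y * z k (Sum.inl ())) * f (z k ∘ Sum.inr))) := by
    refine hasSum_sum fun k _ => HasSum.mul_left _ (HasSum.mul_right _ ?_)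
    rw [Real.exp_eq_exp_ℝ]
    exact NormedSpace.expSeries_div_hasSum_exp _
  rw [← key.tsum_eq]
  refine tsum_nonneg fun m => ?_
  have h := hf κ (fun k => w k * z k (Sum.inl ()) ^ m) (fun k => z k ∘ Sum.inr)
    (fun k i => hz k _) fun n => by
      refine (hn (Sum.elim (fun _ => m) n)).trans_eq (Finset.sum_congr rfl fun k _ => ?_)
      simp [Fintype.prod_sum_type, mul_assoc]
  have h2 := mul_nonneg (show 0 ≤ y ^ m / m.factorial by positivity) h
  rw [Finset.mul_sum] at h2
  refine h2.trans_eq (Finset.sum_congr rfl fun k _ => ?_)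
  rw [mul_pow]
  ring

theorem integral {Ω : Type*} [MeasurableSpace Ω] {ν : Measure Ω} {F : Ω → (ι → ℝ) → ℝ}
    {f : (ι → ℝ) → ℝ} (hF : ∀ᵐ ω ∂ν, AbsMono (F ω))
    (hpos : ∀ z, (∀ i, z i ∈ Set.Icc (0 : ℝ) 1) → f z ≠ 0)
    (hf : ∀ z, (∀ i, z i ∈ Set.Icc (0 : ℝ) 1) → ∫ ω, F ω z ∂ν = f z) : AbsMono f := by
  intro κ _ w z hz hn
  have hint : ∀ k, Integrable (fun ω => F ω (z k)) ν := fun k => by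
    by_contra h
    exact hpos _ (hz k) ((hf _ (hz k)).symm.trans (integral_undef h))
  have : ∑ k, w k * f (z k) = ∫ ω, ∑ k, w k * F ω (z k) ∂ν := by
    rw [integral_finsetSum _ fun k _ => (hint k).const_mul _]
    exact Finset.sum_congr rfl fun k _ => by rw [integral_const_mul, hf _ (hz k)]
  rw [this]
  exact integral_nonneg_of_ae (hF.mono fun ω h => h κ w z hz hn)

end AbsMono

theorem integral_exp_quadratic_gaussianReal {a : ℝ} (ha : a < 1) (b c : ℝ) :
    ∫ g, Real.exp ((c + 2 * b * g + a * g ^ 2) / 2) ∂(ProbabilityTheory.gaussianReal 0 1) =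
      (1 - a) ^ (-(1 / 2) : ℝ) * Real.exp ((c + (1 - a)⁻¹ * b ^ 2) / 2) := by
  have ha' : 0 < 1 - a := by linarith
  rw [ProbabilityTheory.integral_gaussianReal_eq_integral_smul one_ne_zero]
  have h1 : ∀ g : ℝ, ProbabilityTheory.gaussianPDFReal 0 1 g •
      Real.exp ((c + 2 * b * g + a * g ^ 2) / 2) =
      ((√(2 * Real.pi))⁻¹ * Real.exp ((c + (1 - a)⁻¹ * b ^ 2) / 2)) *
        Real.exp (-((1 - a) / 2) * (g - b / (1 - a)) ^ 2) := by
    intro g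
    rw [ProbabilityTheory.gaussianPDFReal]
    simp only [NNReal.coe_one, mul_one, sub_zero, smul_eq_mul]
    rw [mul_assoc _ (Real.exp _), mul_assoc _ (Real.exp _), ← Real.exp_add, ← Real.exp_add]
    congr 2
    field_simp
    ring_nf
  simp_rw [h1]
  rw [integral_const_mul, integral_sub_right_eq_self fun g => Real.exp (-((1 - a) / 2) * g ^ 2),
    integral_gaussian, mul_comm, ← mul_assoc]
  congr 1
  rw [Real.rpow_neg ha'.le, ← Real.sqrt_eq_rpow, ← Real.sqrt_inv, ← Real.sqrt_inv,
    ← Real.sqrt_mul (by positivity)]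
  congr 1
  field_simp

section QuadKernel

variable {ι : Type} [Fintype ι] [DecidableEq ι]

/-- The matrix `Z (1 - C Z)⁻¹` with `Z = diag z`. -/
noncomputable def quadKernel (C : Matrix ι ι ℝ) (z : ι → ℝ) : Matrix ι ι ℝ :=
  diagonal z * (1 - C * diagonal z)⁻¹

theorem det_one_sub_mul_diagonal_pos {C : Matrix ι ι ℝ} (hC : (1 - C).PosDef) {z : ι → ℝ}
    (hz : ∀ i, z i ∈ Set.Icc (0 : ℝ) 1) : 0 < (1 - C * diagonal z).det := by
  have hR : diagonal z = diagonal (fun i => √(z i)) * diagonal (fun i => √(z i)) := by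
    rw [diagonal_mul_diagonal]
    congr 1
    ext i
    exact (Real.mul_self_sqrt (hz i).1).symm
  set R : Matrix ι ι ℝ := diagonal (fun i => √(z i)) with hRdef
  have hRt : Rᵀ = R := diagonal_transpose _
  rw [hR, ← mul_assoc, det_one_sub_mul_comm, ← mul_assoc]
  refine PosDef.det_pos ?_
  have hdec : 1 - R * C * R = diagonal (fun i => 1 - z i) + R * (1 - C) * R := by
    rw [mul_sub, sub_mul, mul_one, ← hR, ← sub_eq_zero]
    have : diagonal (fun i => 1 - z i) = 1 - diagonal z := by
      rw [← diagonal_one, diagonal_sub]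
    rw [this]
    abel
  have hRH : Rᴴ = R := by rw [conjTranspose_eq_transpose_of_trivial, hRt]
  have h1 : (diagonal (fun i => 1 - z i)).PosSemidef :=
    PosSemidef.diagonal fun i => sub_nonneg.2 (hz i).2
  have h2 : (R * (1 - C) * R).PosSemidef := by
    have := hC.posSemidef.mul_mul_conjTranspose_same R
    rwa [hRH] at this
  rw [hdec]
  refine PosDef.of_dotProduct_mulVec_pos (h1.add h2).1 fun x hx => ?_
  rw [add_mulVec, dotProduct_add]
  by_cases hy : R *ᵥ x = 0
  · refine add_pos_of_pos_of_nonneg ?_ (h2.dotProduct_mulVec_nonneg x)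
    have hzx : diagonal z *ᵥ x = 0 := by rw [hR, ← mulVec_mulVec, hy, mulVec_zero]
    have : (diagonal fun i => 1 - z i) *ᵥ x = x := by
      have h3 : diagonal (fun i => 1 - z i) = 1 - diagonal z := by
        rw [← diagonal_one, diagonal_sub]
      rw [h3, sub_mulVec, hzx, one_mulVec, sub_zero]
    rw [this]
    simpa using (dotProduct_star_self_pos_iff (v := x)).2 hx
  · refine add_pos_of_nonneg_of_pos (h1.dotProduct_mulVec_nonneg x) ?_
    have := hC.dotProduct_mulVec_pos hy
    rw [← mulVec_mulVec, ← mulVec_mulVec, dotProduct_mulVec (star x)]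
    rwa [star_mulVec, hRH] at this

theorem quadKernel_mul {C : Matrix ι ι ℝ} {z : ι → ℝ} (h : (1 - C * diagonal z).det ≠ 0) :
    quadKernel C z * (1 - C * diagonal z) = diagonal z := by
  rw [quadKernel, mul_assoc, nonsing_inv_mul _ (isUnit_iff_ne_zero.2 h), mul_one]

theorem eq_quadKernel {C : Matrix ι ι ℝ} {z : ι → ℝ} (h : (1 - C * diagonal z).det ≠ 0)
    {Q : Matrix ι ι ℝ} (hQ : Q * (1 - C * diagonal z) = diagonal z) : quadKernel C z = Q := by
  rw [← mul_one Q, ← mul_nonsing_inv _ (isUnit_iff_ne_zero.2 h), ← mul_assoc, hQ, quadKernel]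

theorem quadKernel_transpose {C : Matrix ι ι ℝ} (hC : Cᵀ = C) {z : ι → ℝ}
    (h : (1 - C * diagonal z).det ≠ 0) : (quadKernel C z)ᵀ = quadKernel C z := by
  symm
  apply eq_quadKernel h
  rw [quadKernel, transpose_mul, diagonal_transpose, transpose_nonsing_inv, transpose_sub,
    transpose_mul, transpose_one, diagonal_transpose, hC, mul_assoc]
  have h' : IsUnit (1 - diagonal z * C).det := by
    rw [det_one_sub_mul_comm]
    exact isUnit_iff_ne_zero.2 h
  have : diagonal z * (1 - C * diagonal z) = (1 - diagonal z * C) * diagonal z := by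
    rw [mul_sub, sub_mul, mul_one, one_mul, mul_assoc]
  rw [this, ← mul_assoc, nonsing_inv_mul _ h', one_mul]

theorem vecMulVec_mul_diagonal (l : ι → ℝ) (z : ι → ℝ) :
    vecMulVec l l * diagonal z = vecMulVec l (diagonal z *ᵥ l) := by
  ext i j
  rw [mul_diagonal, vecMulVec_apply, vecMulVec_apply, mulVec_diagonal, mul_assoc, mul_comm (z j)]

theorem one_sub_rankOne_add (C : Matrix ι ι ℝ) (l : ι → ℝ) (z : ι → ℝ) :
    1 - (vecMulVec l l + C) * diagonal z =
      (1 - C * diagonal z) - vecMulVec l (diagonal z *ᵥ l) := by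
  rw [add_mul, vecMulVec_mul_diagonal]
  abel

theorem det_rankOne_add (C : Matrix ι ι ℝ) (l : ι → ℝ) {z : ι → ℝ}
    (h : (1 - C * diagonal z).det ≠ 0) :
    (1 - (vecMulVec l l + C) * diagonal z).det =
      (1 - C * diagonal z).det * (1 - l ⬝ᵥ (quadKernel C z *ᵥ l)) := by
  rw [one_sub_rankOne_add, sub_eq_add_neg, ← vecMulVec_neg, vecMulVec_eq Unit,
    det_add_replicateCol_mul_replicateRow (isUnit_iff_ne_zero.2 h), det_unique (n := Unit)]
  congr 1
  rw [Matrix.add_apply, one_apply_eq, sub_eq_add_neg (1 : ℝ)]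
  congr 1
  rw [← replicateRow_vecMul, replicateRow_mul_replicateCol_apply, neg_vecMul, neg_dotProduct]
  congr 1
  rw [← dotProduct_mulVec, quadKernel, ← mulVec_mulVec]
  simp only [dotProduct, mulVec_diagonal]
  exact Finset.sum_congr rfl fun i _ => by rw [mul_comm (z i), mul_assoc]

theorem quadKernel_rankOne_add {C : Matrix ι ι ℝ} (hC : Cᵀ = C) (l : ι → ℝ) {z : ι → ℝ}
    (h : (1 - C * diagonal z).det ≠ 0) (hl : 1 - l ⬝ᵥ (quadKernel C z *ᵥ l) ≠ 0) (v : ι → ℝ) :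
    v ⬝ᵥ (quadKernel (vecMulVec l l + C) z *ᵥ v) = v ⬝ᵥ (quadKernel C z *ᵥ v) +
      (1 - l ⬝ᵥ (quadKernel C z *ᵥ l))⁻¹ * (v ⬝ᵥ (quadKernel C z *ᵥ l)) ^ 2 := by
  set a := l ⬝ᵥ (quadKernel C z *ᵥ l) with ha
  set q := quadKernel C z *ᵥ l with hq
  have hdet : (1 - (vecMulVec l l + C) * diagonal z).det ≠ 0 := by
    rw [det_rankOne_add C l h]
    exact mul_ne_zero h hl
  have hqB : q ᵥ* (1 - C * diagonal z) = diagonal z *ᵥ l := by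
    rw [hq, ← vecMul_transpose, quadKernel_transpose hC h, vecMul_vecMul, quadKernel_mul h,
      ← mulVec_transpose, diagonal_transpose]
  have hQ : quadKernel (vecMulVec l l + C) z = quadKernel C z + (1 - a)⁻¹ • vecMulVec q q := by
    refine eq_quadKernel hdet ?_
    rw [one_sub_rankOne_add, mul_sub, add_mul, add_mul, quadKernel_mul h, smul_mul_assoc,
      smul_mul_assoc, vecMulVec_mul, hqB, mul_vecMulVec, ← hq, vecMulVec_mul_vecMulVec,
      dotProduct_comm q l, ← ha]
    rw [vecMulVec_smul, smul_smul]
    have : (1 - a)⁻¹ - 1 - (1 - a)⁻¹ * a = 0 := by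
      rw [sub_right_comm, ← mul_one_sub, inv_mul_cancel₀ hl, sub_self]
    rw [add_sub_assoc, ← sub_sub, ← one_smul ℝ (vecMulVec q (diagonal z *ᵥ l)), smul_smul,
      smul_smul, mul_one, mul_one, ← sub_smul, ← sub_smul, this, zero_smul, add_zero]
  rw [hQ, add_mulVec, dotProduct_add, smul_mulVec, dotProduct_smul, vecMulVec_mulVec,
    smul_eq_mul]
  congr 2
  simp only [op_smul_eq_smul, dotProduct_smul, smul_eq_mul]
  rw [dotProduct_comm q v, sq]

end QuadKernel

section Wishart

variable {ι : Type} [Fintype ι] [DecidableEq ι]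

/-- The moment generating function of half the diagonal of a noncentral Wishart matrix with `N`
degrees of freedom, scale matrix `C` and noncentrality vectors `v`. -/
noncomputable def wishartMGF {r : ℕ} (N : ℝ) (C : Matrix ι ι ℝ) (v : Fin r → ι → ℝ) (z : ι → ℝ) :
    ℝ :=
  (1 - C * diagonal z).det ^ (-(N / 2)) *
    Real.exp ((∑ k, v k ⬝ᵥ (quadKernel C z *ᵥ v k)) / 2)

/-- `wishartMGF` multiplied by a power of the factor by which a rank one update `C + l lᵀ`
changes the determinant. -/
noncomputable def wishartMGFAux {r : ℕ} (N ε : ℝ) (C : Matrix ι ι ℝ) (l : ι → ℝ)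
    (v : Fin r → ι → ℝ) (z : ι → ℝ) : ℝ :=
  (1 - l ⬝ᵥ (quadKernel C z *ᵥ l)) ^ (-(ε / 2)) * wishartMGF N C v z

theorem one_sub_quadKernel_pos {C : Matrix ι ι ℝ} {l : ι → ℝ} {z : ι → ℝ}
    (h : 0 < (1 - C * diagonal z).det)
    (h' : 0 < (1 - (vecMulVec l l + C) * diagonal z).det) :
    0 < 1 - l ⬝ᵥ (quadKernel C z *ᵥ l) := by
  rw [det_rankOne_add C l h.ne'] at h'
  exact (mul_pos_iff_of_pos_left h).1 h'

theorem quadKernel_form_add_smul {C : Matrix ι ι ℝ} (hC : Cᵀ = C) {z : ι → ℝ}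
    (h : (1 - C * diagonal z).det ≠ 0) (v l : ι → ℝ) (g : ℝ) :
    (v + g • l) ⬝ᵥ (quadKernel C z *ᵥ (v + g • l)) = v ⬝ᵥ (quadKernel C z *ᵥ v) +
      2 * (v ⬝ᵥ (quadKernel C z *ᵥ l)) * g + l ⬝ᵥ (quadKernel C z *ᵥ l) * g ^ 2 := by
  have hs : l ⬝ᵥ (quadKernel C z *ᵥ v) = v ⬝ᵥ (quadKernel C z *ᵥ l) := by
    rw [dotProduct_comm, dotProduct_mulVec v, ← mulVec_transpose, quadKernel_transpose hC h]
  simp only [mulVec_add, mulVec_smul, add_dotProduct, dotProduct_add, smul_dotProduct,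
    dotProduct_smul, smul_eq_mul, hs]
  ring

theorem absMono_wishartMGF_rankOne_add {r : ℕ} {N ε : ℝ} (hN : N = ε + r) {C : Matrix ι ι ℝ}
    (hC : Cᵀ = C) {l : ι → ℝ} {v : Fin r → ι → ℝ}
    (h : ∀ z, (∀ i, z i ∈ Set.Icc (0 : ℝ) 1) → 0 < (1 - C * diagonal z).det)
    (h' : ∀ z, (∀ i, z i ∈ Set.Icc (0 : ℝ) 1) →
      0 < (1 - (vecMulVec l l + C) * diagonal z).det)
    (hv : ∀ u : Fin r → ℝ, AbsMono (wishartMGFAux N ε C l fun k => v k + u k • l)) :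
    AbsMono (wishartMGF N (vecMulVec l l + C) v) := by
  refine AbsMono.integral (ν := Measure.pi fun _ : Fin r => ProbabilityTheory.gaussianReal 0 1)
    (F := fun u => wishartMGFAux N ε C l fun k => v k + u k • l)
    (Filter.Eventually.of_forall hv)
    (fun z hz => (mul_pos (Real.rpow_pos_of_pos (h' z hz) _) (Real.exp_pos _)).ne') fun z hz => ?_
  have hd := h z hz
  have ha := one_sub_quadKernel_pos hd (h' z hz)
  simp only [wishartMGFAux, wishartMGF, quadKernel_form_add_smul hC hd.ne',
    quadKernel_rankOne_add hC l hd.ne' ha.ne', det_rankOne_add C l hd.ne', Finset.sum_div,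
    Real.exp_sum]
  rw [integral_const_mul, integral_const_mul, integral_fintype_prod_eq_prod (𝕜 := ℝ)
    fun (k : Fin r) (g : ℝ) => Real.exp ((v k ⬝ᵥ (quadKernel C z *ᵥ v k) +
      2 * (v k ⬝ᵥ (quadKernel C z *ᵥ l)) * g + l ⬝ᵥ (quadKernel C z *ᵥ l) * g ^ 2) / 2)]
  simp_rw [integral_exp_quadratic_gaussianReal (sub_pos.1 ha)]
  rw [Finset.prod_mul_distrib, Finset.prod_const, Finset.card_univ, Fintype.card_fin,
    Real.mul_rpow hd.le ha.le, ← Real.rpow_natCast, ← Real.rpow_mul ha.le]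
  have : -(N / 2) = -(ε / 2) + -(1 / 2) * (r : ℝ) := by rw [hN]; ring
  nth_rw 3 [this]
  rw [Real.rpow_add ha]
  ring

theorem absMono_wishartMGFAux_of_pos {r : ℕ} {N ε : ℝ} (hε : 0 < ε) {C : Matrix ι ι ℝ}
    {l : ι → ℝ} {v : Fin r → ι → ℝ}
    (h : ∀ z, (∀ i, z i ∈ Set.Icc (0 : ℝ) 1) → 0 < (1 - C * diagonal z).det)
    (h' : ∀ z, (∀ i, z i ∈ Set.Icc (0 : ℝ) 1) →
      0 < (1 - (vecMulVec l l + C) * diagonal z).det)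
    (hv : ∀ s : ℝ, AbsMono (wishartMGF N C
      (Fin.snoc (α := fun _ => ι → ℝ) v (s • l) : Fin (r + 1) → ι → ℝ))) :
    AbsMono (wishartMGFAux N ε C l v) := by
  refine AbsMono.integral (ν := volume.restrict (Set.Ioi (0 : ℝ)))
    (F := fun s z => (s ^ (ε / 2 - 1) * Real.exp (-s) / Real.Gamma (ε / 2)) * wishartMGF N C
      (Fin.snoc (α := fun _ => ι → ℝ) v (√(2 * s) • l) : Fin (r + 1) → ι → ℝ) z)
    ?_ (fun z hz => ?_) fun z hz => ?_
  · refine (ae_restrict_mem measurableSet_Ioi).mono fun s hs => (hv _).const_mul ?_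
    have hs' : 0 < s := hs
    have := Real.Gamma_pos_of_pos (half_pos hε)
    positivity
  · have hd := h z hz
    have ha := one_sub_quadKernel_pos hd (h' z hz)
    rw [wishartMGFAux, wishartMGF]
    have := Real.rpow_pos_of_pos ha (-(ε / 2))
    have := Real.rpow_pos_of_pos hd (-(N / 2))
    positivity
  · have hd := h z hz
    have ha := one_sub_quadKernel_pos hd (h' z hz)
    have hG := Real.Gamma_pos_of_pos (half_pos hε)
    have key : ∀ s ∈ Set.Ioi (0 : ℝ),
        (s ^ (ε / 2 - 1) * Real.exp (-s) / Real.Gamma (ε / 2)) * wishartMGF N C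
          (Fin.snoc (α := fun _ => ι → ℝ) v (√(2 * s) • l) : Fin (r + 1) → ι → ℝ) z =
        (wishartMGF N C v z / Real.Gamma (ε / 2)) * (s ^ (ε / 2 - 1) *
          Real.exp (-((1 - l ⬝ᵥ (quadKernel C z *ᵥ l)) * s))) := by
      intro s hs
      have hs' : (0 : ℝ) < s := hs
      have hsq : √(2 * s) * √(2 * s) = 2 * s := Real.mul_self_sqrt (by positivity)
      simp only [wishartMGF, Fin.sum_univ_castSucc, Fin.snoc_castSucc, Fin.snoc_last,
        mulVec_smul, smul_dotProduct, dotProduct_smul, smul_eq_mul]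
      rw [← mul_assoc √(2 * s), hsq, add_div, Real.exp_add,
        show -((1 - l ⬝ᵥ (quadKernel C z *ᵥ l)) * s) =
          -s + 2 * s * (l ⬝ᵥ (quadKernel C z *ᵥ l)) / 2 by ring, Real.exp_add]
      ring
    rw [setIntegral_congr_fun measurableSet_Ioi key, integral_const_mul,
      Real.integral_rpow_mul_exp_neg_mul_Ioi (half_pos hε) ha, wishartMGFAux,
      Real.rpow_neg ha.le, one_div, Real.inv_rpow ha.le]
    field_simp

theorem one_sub_fromBlocks_mul_diagonal (C : Matrix ι ι ℝ) (z : Unit ⊕ ι → ℝ) :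
    1 - fromBlocks 0 0 0 C * diagonal z =
      fromBlocks 1 0 0 (1 - C * diagonal (z ∘ Sum.inr)) := by
  have hz : diagonal z = fromBlocks (diagonal (z ∘ Sum.inl)) 0 0 (diagonal (z ∘ Sum.inr)) := by
    rw [fromBlocks_diagonal, Sum.elim_comp_inl_inr]
  rw [hz, fromBlocks_multiply, ← fromBlocks_one, sub_eq_add_neg, fromBlocks_neg, fromBlocks_add]
  simp [sub_eq_add_neg]

theorem wishartMGF_fromBlocks {r : ℕ} (N : ℝ) (C : Matrix ι ι ℝ) (v : Fin r → Unit ⊕ ι → ℝ)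
    {z : Unit ⊕ ι → ℝ} (h : (1 - C * diagonal (z ∘ Sum.inr)).det ≠ 0) :
    wishartMGF N (fromBlocks 0 0 0 C) v z =
      Real.exp ((∑ k, v k (Sum.inl ()) ^ 2) / 2 * z (Sum.inl ())) *
        wishartMGF N C (fun k => v k ∘ Sum.inr) (z ∘ Sum.inr) := by
  have hdet : (1 - fromBlocks 0 0 0 C * diagonal z).det =
      (1 - C * diagonal (z ∘ Sum.inr)).det := by
    rw [one_sub_fromBlocks_mul_diagonal, det_fromBlocks_zero₂₁, det_one, one_mul]
  have hQ : quadKernel (fromBlocks 0 0 0 C) z =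
      fromBlocks (diagonal (z ∘ Sum.inl)) 0 0 (quadKernel C (z ∘ Sum.inr)) := by
    apply eq_quadKernel (by rwa [hdet])
    rw [one_sub_fromBlocks_mul_diagonal, fromBlocks_multiply, quadKernel_mul h]
    simp only [Matrix.mul_zero, Matrix.zero_mul, mul_one, add_zero, zero_add]
    rw [fromBlocks_diagonal, Sum.elim_comp_inl_inr]
  have hq : ∀ k, v k ⬝ᵥ (quadKernel (fromBlocks 0 0 0 C) z *ᵥ v k) =
      v k (Sum.inl ()) ^ 2 * z (Sum.inl ()) +
        (v k ∘ Sum.inr) ⬝ᵥ (quadKernel C (z ∘ Sum.inr) *ᵥ (v k ∘ Sum.inr)) := by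
    intro k
    rw [hQ, fromBlocks_mulVec, zero_mulVec, zero_mulVec, add_zero, zero_add]
    nth_rw 1 [← Sum.elim_comp_inl_inr (v k)]
    rw [sumElim_dotProduct_sumElim]
    congr 1
    simp [dotProduct, mulVec_diagonal]
    ring
  rw [wishartMGF, wishartMGF, hdet]
  simp_rw [hq]
  rw [Finset.sum_add_distrib, ← Finset.sum_mul, add_div, Real.exp_add, mul_div_right_comm]
  ring

end Wishart

theorem dotProduct_vecMulVec_add_fromBlocks_mulVec {ι : Type} [Fintype ι]
    (l y : Unit ⊕ ι → ℝ) (C : Matrix ι ι ℝ) :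
    y ⬝ᵥ ((vecMulVec l l + fromBlocks 0 0 0 C) *ᵥ y) =
      (l ⬝ᵥ y) ^ 2 + (y ∘ Sum.inr) ⬝ᵥ (C *ᵥ (y ∘ Sum.inr)) := by
  rw [add_mulVec, dotProduct_add, vecMulVec_mulVec, fromBlocks_mulVec]
  congr 1
  · simp only [op_smul_eq_smul, dotProduct_smul, smul_eq_mul]
    rw [dotProduct_comm y l, sq]
  · nth_rw 1 [← Sum.elim_comp_inl_inr y]
    rw [sumElim_dotProduct_sumElim]
    simp

section Cholesky

variable {ι : Type} [Fintype ι] [DecidableEq ι]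

theorem exists_eq_vecMulVec_add_fromBlocks {C : Matrix (Unit ⊕ ι) (Unit ⊕ ι) ℝ} (hC : C.PosDef)
    (hC1 : (1 - C).PosDef) : ∃ (l : Unit ⊕ ι → ℝ) (C' : Matrix ι ι ℝ),
      C = vecMulVec l l + fromBlocks 0 0 0 C' ∧ C'.PosDef ∧ (1 - C').PosDef := by
  have hCs : ∀ i j, C i j = C j i := fun i j => by
    have := congrFun (congrFun hC.1 j) i
    simpa using this
  have h0 : 0 < C (Sum.inl ()) (Sum.inl ()) := hC.diag_pos
  set c := C (Sum.inl ()) (Sum.inl ()) with hc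
  have hsq : √c * √c = c := Real.mul_self_sqrt h0.le
  have hs0 : √c ≠ 0 := (Real.sqrt_pos.2 h0).ne'
  set l : Unit ⊕ ι → ℝ := fun i => C i (Sum.inl ()) / √c with hl
  set C' : Matrix ι ι ℝ := Matrix.of fun i j => C (Sum.inr i) (Sum.inr j) -
    l (Sum.inr i) * l (Sum.inr j) with hC'
  have hl0 : l (Sum.inl ()) = √c := by
    simp only [hl, ← hc]
    rw [div_eq_iff hs0, hsq]
  have heq : C = vecMulVec l l + fromBlocks 0 0 0 C' := by
    ext i j
    rcases i with i | i <;> rcases j with j | j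
    · simp [vecMulVec_apply, hl0, hsq, ← hc]
    · simp only [Matrix.add_apply, vecMulVec_apply, fromBlocks_apply₁₂, Matrix.zero_apply, add_zero]
      rw [hl0, hCs]
      simp only [hl]
      field_simp
    · simp only [Matrix.add_apply, vecMulVec_apply, fromBlocks_apply₂₁, Matrix.zero_apply, add_zero]
      rw [hl0]
      simp only [hl]
      field_simp
    · simp [vecMulVec_apply, hC']
  have hH : C'.IsHermitian := by
    ext i j
    simp only [hC', conjTranspose_apply, of_apply, star_trivial]
    rw [hCs, mul_comm]
  have hform := dotProduct_vecMulVec_add_fromBlocks_mulVec l (C := C')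
  rw [← heq] at hform
  refine ⟨l, C', heq, PosDef.of_dotProduct_mulVec_pos hH fun x hx => ?_,
    PosDef.of_dotProduct_mulVec_pos (isHermitian_one.sub hH) fun x hx => ?_⟩
  · set y : Unit ⊕ ι → ℝ := Sum.elim (fun _ => -((l ∘ Sum.inr) ⬝ᵥ x) / √c) x with hy
    have hy0 : y ≠ 0 := fun h => hx (funext fun i => congrFun h (Sum.inr i))
    have h1 := hC.dotProduct_mulVec_pos hy0
    rw [star_trivial, hform] at h1
    have h2 : l ⬝ᵥ y = 0 := by
      rw [← Sum.elim_comp_inl_inr l, hy, sumElim_dotProduct_sumElim]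
      simp only [dotProduct, Finset.univ_unique, Finset.sum_singleton, Function.comp]
      rw [show (default : Unit) = () from rfl, hl0]
      field_simp
      ring
    rw [h2] at h1
    simpa [hy] using h1
  · set y : Unit ⊕ ι → ℝ := Sum.elim 0 x with hy
    have hy0 : y ≠ 0 := fun h => hx (funext fun i => congrFun h (Sum.inr i))
    have h1 := hC1.dotProduct_mulVec_pos hy0
    rw [star_trivial, sub_mulVec, dotProduct_sub, hform, one_mulVec] at h1
    rw [star_trivial, sub_mulVec, dotProduct_sub, one_mulVec]
    have h2 : y ⬝ᵥ y = x ⬝ᵥ x := by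
      rw [hy, sumElim_dotProduct_sumElim]
      simp
    have h3 : y ∘ Sum.inr = x := by rw [hy, Sum.elim_comp_inr]
    rw [h2, h3] at h1
    nlinarith [sq_nonneg (l ⬝ᵥ y)]

open scoped MatrixOrder in
theorem exists_square_family {r : ℕ} (v : Fin r → ι → ℝ) :
    ∃ w : ι → ι → ℝ, ∀ Q : Matrix ι ι ℝ,
      ∑ k, v k ⬝ᵥ (Q *ᵥ v k) = ∑ k, w k ⬝ᵥ (Q *ᵥ w k) := by
  have hform : ∀ (κ : Type) [Fintype κ] (V : κ → ι → ℝ) (Q : Matrix ι ι ℝ),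
      ∑ k, V k ⬝ᵥ (Q *ᵥ V k) = (Q * ((Matrix.of V)ᵀ * Matrix.of V)).trace := by
    intro κ _ V Q
    rw [← Matrix.mul_assoc, trace_mul_comm, trace]
    refine Finset.sum_congr rfl fun k _ => ?_
    rw [diag_apply, mul_apply, dotProduct]
    refine Finset.sum_congr rfl fun i _ => ?_
    rw [mul_apply]
    rfl
  have hA : ((Matrix.of v)ᵀ * Matrix.of v).PosSemidef := by
    have := posSemidef_conjTranspose_mul_self (Matrix.of v)
    rwa [conjTranspose_eq_transpose_of_trivial] at this
  obtain ⟨B, hB⟩ := CStarAlgebra.nonneg_iff_eq_star_mul_self.mp hA.nonneg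
  rw [star_eq_conjTranspose, conjTranspose_eq_transpose_of_trivial] at hB
  refine ⟨Matrix.of.symm B, fun Q => ?_⟩
  rw [hform, hform, hB, Equiv.apply_symm_apply]

theorem wishartMGF_submatrix {ι' : Type} [Fintype ι'] [DecidableEq ι'] {r : ℕ} (N : ℝ)
    (C : Matrix ι ι ℝ) (v : Fin r → ι → ℝ) (e : ι' ≃ ι) (z : ι → ℝ) :
    wishartMGF N (C.submatrix e e) (fun k => v k ∘ e) (z ∘ e) = wishartMGF N C v z := by
  have h1 : (1 - C.submatrix e e * diagonal (z ∘ e)) = (1 - C * diagonal z).submatrix e e := by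
    rw [submatrix_sub, Pi.sub_apply, Pi.sub_apply, submatrix_one_equiv,
      ← submatrix_mul_equiv C (diagonal z) e e e, submatrix_diagonal_equiv]
  have h2 : quadKernel (C.submatrix e e) (z ∘ e) = (quadKernel C z).submatrix e e := by
    rw [quadKernel, quadKernel, h1, inv_submatrix_equiv, ← submatrix_diagonal_equiv,
      submatrix_mul_equiv]
  rw [wishartMGF, wishartMGF, h1, det_submatrix_equiv_self, h2]
  congr 3
  refine Finset.sum_congr rfl fun k _ => ?_
  rw [submatrix_mulVec_equiv, Function.comp_assoc, e.self_comp_symm, Function.comp_id,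
    comp_equiv_dotProduct_comp_equiv]

end Cholesky

theorem absMono_wishartMGF (d : ℕ) : ∀ (r : ℕ) (N : ℝ) (C : Matrix (Fin d) (Fin d) ℝ)
    (v : Fin r → Fin d → ℝ), C.PosDef → (1 - C).PosDef → (N = r ∨ (r ≤ d ∧ (r : ℝ) + d ≤ 2 * N)) →
      AbsMono (wishartMGF N C v) := by
  induction d with
  | zero =>
    intro r N C v _ _ _
    refine AbsMono.one.congr fun z _ => ?_
    simp [wishartMGF]
  | succ d ih =>
    intro r N C v hC hC1 hr
    set e : Unit ⊕ Fin d ≃ Fin (d + 1) :=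
      (Equiv.sumComm _ _).trans ((Equiv.optionEquivSumPUnit _).symm.trans (finSuccEquiv d).symm)
    suffices h : AbsMono (wishartMGF N (C.submatrix e e) fun k => v k ∘ e) by
      refine (h.reindex e).congr fun z _ => (wishartMGF_submatrix N C v e z).symm
    have hCe : (C.submatrix e e).PosDef := hC.submatrix e.injective
    have hC1e : (1 - C.submatrix e e).PosDef := by
      have := hC1.submatrix e.injective
      rwa [submatrix_sub, Pi.sub_apply, Pi.sub_apply, submatrix_one_equiv] at this
    obtain ⟨l, C', heq, hC', hC1'⟩ := exists_eq_vecMulVec_add_fromBlocks hCe hC1e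
    rw [heq]
    have hdet' : ∀ z : Unit ⊕ Fin d → ℝ, (∀ i, z i ∈ Set.Icc (0 : ℝ) 1) →
        0 < (1 - C' * diagonal (z ∘ Sum.inr)).det :=
      fun z hz => det_one_sub_mul_diagonal_pos hC1' fun i => hz _
    have hdet : ∀ z : Unit ⊕ Fin d → ℝ, (∀ i, z i ∈ Set.Icc (0 : ℝ) 1) →
        0 < (1 - fromBlocks 0 0 0 C' * diagonal z).det := fun z hz => by
      rw [one_sub_fromBlocks_mul_diagonal, det_fromBlocks_zero₂₁, det_one, one_mul]
      exact hdet' z hz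
    have hdetl : ∀ z : Unit ⊕ Fin d → ℝ, (∀ i, z i ∈ Set.Icc (0 : ℝ) 1) →
        0 < (1 - (vecMulVec l l + fromBlocks 0 0 0 C') * diagonal z).det := fun z hz => by
      rw [← heq]
      exact det_one_sub_mul_diagonal_pos hC1e hz
    have hsymm : (fromBlocks 0 0 0 C' : Matrix (Unit ⊕ Fin d) (Unit ⊕ Fin d) ℝ)ᵀ =
        fromBlocks 0 0 0 C' := by
      rw [fromBlocks_transpose]
      have := hC'.1
      rw [IsHermitian, conjTranspose_eq_transpose_of_trivial] at this
      simp [this]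
    have hstep : ∀ (s : ℕ) (u : Fin s → Unit ⊕ Fin d → ℝ),
        AbsMono (wishartMGF N C' fun k => u k ∘ Sum.inr) →
          AbsMono (wishartMGF N (fromBlocks 0 0 0 C') u) := fun s u hu =>
      (hu.exp_mul (y := (∑ k, u k (Sum.inl ()) ^ 2) / 2)
        (div_nonneg (Finset.sum_nonneg fun k _ => sq_nonneg _) zero_le_two)).congr
        fun z hz => wishartMGF_fromBlocks N C' u (hdet' z hz).ne'
    refine absMono_wishartMGF_rankOne_add (ε := N - r) (by ring) hsymm hdet hdetl fun u => ?_
    by_cases hNr : N = r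
    · have : wishartMGFAux N (N - r) (fromBlocks 0 0 0 C') l (fun k => v k ∘ e + u k • l) =
          wishartMGF N (fromBlocks 0 0 0 C') (fun k => v k ∘ e + u k • l) := by
        ext z
        simp [wishartMGFAux, hNr]
      rw [this]
      exact hstep _ _ (ih _ _ _ _ hC' hC1' (Or.inl hNr))
    · obtain ⟨hrd, hN⟩ := hr.resolve_left hNr
      have hrd' : (r : ℝ) ≤ d + 1 := by exact_mod_cast hrd
      push_cast at hN
      have hpos : 0 < N - r := lt_of_le_of_ne (by linarith) (Ne.symm (sub_ne_zero.2 hNr))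
      refine absMono_wishartMGFAux_of_pos hpos hdet hdetl fun s => hstep _ _ ?_
      rcases Nat.lt_or_ge r d with hlt | hge
      · refine ih _ _ _ _ hC' hC1' (Or.inr ⟨hlt, ?_⟩)
        push_cast
        linarith
      · obtain ⟨w, hw⟩ := exists_square_family fun k =>
          (Fin.snoc (α := fun _ => Unit ⊕ Fin d → ℝ) (fun k => v k ∘ e + u k • l) (s • l) :
            Fin (r + 1) → Unit ⊕ Fin d → ℝ) k ∘ Sum.inr
        refine (ih d N C' w hC' hC1' (Or.inr ⟨le_rfl, ?_⟩)).congr fun z _ => ?_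
        · have : (d : ℝ) ≤ r := by exact_mod_cast hge
          linarith
        · rw [wishartMGF, wishartMGF, hw]

theorem absMono_det_rpow {ι : Type} [Fintype ι] [DecidableEq ι] {A : Matrix ι ι ℝ}
    (hA : A.PosDef) (hA1 : (1 - A).PosDef) {N : ℝ}
    (hN : (∃ n : ℕ, N = n) ∨ (Fintype.card ι : ℝ) ≤ 2 * N) :
    AbsMono fun z => (1 - A * diagonal z).det ^ (-(N / 2)) := by
  set e : Fin (Fintype.card ι) ≃ ι := (Fintype.equivFin ι).symm
  have hAe : (A.submatrix e e).PosDef := hA.submatrix e.injective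
  have hA1e : (1 - A.submatrix e e).PosDef := by
    have := hA1.submatrix e.injective
    rwa [submatrix_sub, Pi.sub_apply, Pi.sub_apply, submatrix_one_equiv] at this
  obtain ⟨r, hr⟩ : ∃ r : ℕ, N = r ∨ (r ≤ Fintype.card ι ∧ (r : ℝ) + Fintype.card ι ≤ 2 * N) := by
    rcases hN with ⟨n, hn⟩ | h
    · exact ⟨n, Or.inl hn⟩
    · exact ⟨0, Or.inr ⟨Nat.zero_le _, by simpa using h⟩⟩
  have h := absMono_wishartMGF _ r N _ (fun k => (fun _ => 0 : ι → ℝ) ∘ e) hAe hA1e hr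
  refine (h.reindex e).congr fun z _ => ?_
  rw [wishartMGF_submatrix N A (fun _ : Fin r => fun _ => 0) e z, wishartMGF]
  have : (fun _ : ι => (0 : ℝ)) = 0 := rfl
  simp [this]

section PrincipalMinor

variable {ι : Type} [Fintype ι] [DecidableEq ι]

/-- The determinant of the principal submatrix of `M` with index set `J`. -/
def principalMinor (M : Matrix ι ι ℝ) (J : Finset ι) : ℝ :=
  (M.submatrix (Subtype.val : J → ι) (Subtype.val : J → ι)).det

theorem det_one_add_mul_diagonal_eq_sum (M : Matrix ι ι ℝ) (t : ι → ℝ) :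
    (1 + M * diagonal t).det = ∑ J : Finset ι, principalMinor M J * ∏ j ∈ J, t j := by
  rw [det_one_add_mul_comm, add_comm]
  have h : (diagonal t * M + 1 : Matrix ι ι ℝ).det = detRowAlternating.toMultilinearMap
      ((fun i => t i • M.row i) + (1 : Matrix ι ι ℝ).row) := by
    change _ = Matrix.det _
    congr 1
    ext i j
    simp [diagonal_mul]
  rw [h, MultilinearMap.map_add_univ]
  refine Finset.sum_congr rfl fun J _ => ?_
  have h2 : J.piecewise (fun i => t i • M.row i) (1 : Matrix ι ι ℝ).row =
      J.piecewise (fun i => t i • (J.piecewise M.row (1 : Matrix ι ι ℝ).row) i)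
        (J.piecewise M.row (1 : Matrix ι ι ℝ).row) := by
    ext i j
    by_cases hi : i ∈ J <;> simp [hi]
  rw [h2, MultilinearMap.map_piecewise_smul, smul_eq_mul, mul_comm]
  congr 1
  exact det_piecewise_one_eq_submatrix_det M J

theorem principalMinor_nonneg {ι : Type} [DecidableEq ι] {M : Matrix ι ι ℝ} (hM : M.PosSemidef)
    (J : Finset ι) : 0 ≤ principalMinor M J :=
  (hM.submatrix _).det_nonneg

theorem det_one_add_mul_diagonal_pos {M : Matrix ι ι ℝ} (hM : M.PosSemidef) {t : ι → ℝ}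
    (ht : ∀ i, 0 ≤ t i) : 1 ≤ (1 + M * diagonal t).det := by
  rw [det_one_add_mul_diagonal_eq_sum]
  refine le_trans ?_ (Finset.single_le_sum (fun J _ => mul_nonneg (principalMinor_nonneg hM J)
    (Finset.prod_nonneg fun j _ => ht j)) (Finset.mem_univ ∅))
  simp [principalMinor]

open scoped MatrixOrder in
theorem det_le_det_add {X Y : Matrix ι ι ℝ} (hX : X.PosSemidef) (hY : Y.PosSemidef) :
    X.det ≤ (X + Y).det := by
  by_cases h0 : X.det = 0
  · rw [h0]
    exact (hX.add hY).det_nonneg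
  obtain ⟨B, hB⟩ := CStarAlgebra.nonneg_iff_eq_star_mul_self.mp hX.nonneg
  rw [star_eq_conjTranspose] at hB
  have hBu : IsUnit B.det := by
    rw [isUnit_iff_ne_zero]
    intro hb
    rw [hB, det_mul, hb, mul_zero] at h0
    exact h0 rfl
  have hBu' : IsUnit Bᴴ.det := by
    rw [det_conjTranspose]
    exact hBu.star
  have hP := hY.conjTranspose_mul_mul_same B⁻¹
  set P := B⁻¹ᴴ * Y * B⁻¹ with hPdef
  have hYP : X + Y = Bᴴ * (1 + P * diagonal 1) * B := by
    have h1 : Bᴴ * B⁻¹ᴴ = 1 := by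
      rw [← conjTranspose_mul, nonsing_inv_mul _ hBu, conjTranspose_one]
    have h2 : Bᴴ * P * B = Y := by
      rw [hPdef, mul_assoc, mul_assoc, nonsing_inv_mul _ hBu, mul_one, ← mul_assoc, h1, one_mul]
    have h3 : (diagonal 1 : Matrix ι ι ℝ) = 1 := diagonal_one
    rw [h3, mul_one, mul_add, add_mul, mul_one, h2, hB]
  have h1 := det_one_add_mul_diagonal_pos hP (t := 1) fun _ => zero_le_one
  calc X.det = X.det * 1 := (mul_one _).symm
    _ ≤ X.det * (1 + P * diagonal 1).det := mul_le_mul_of_nonneg_left h1 hX.det_nonneg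
    _ = (X + Y).det := by
      rw [hYP, det_mul, det_mul, hB, det_mul]
      ring

open scoped MatrixOrder in
theorem exists_pos_smul_sub_one_posDef {M : Matrix ι ι ℝ} (hM : M.PosDef) :
    ∃ c : ℝ, 0 < c ∧ (c • M - 1).PosDef := by
  obtain ⟨B, hB⟩ := CStarAlgebra.nonneg_iff_eq_star_mul_self.mp hM.posSemidef.nonneg
  rw [star_eq_conjTranspose, conjTranspose_eq_transpose_of_trivial] at hB
  have hBu : IsUnit B.det := by
    rw [isUnit_iff_ne_zero]
    intro hb
    have := hM.det_pos
    rw [hB, det_mul, hb, mul_zero] at this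
    exact this.false
  set F : ℝ := ∑ i, ∑ j, B⁻¹ i j ^ 2 with hF
  have hF0 : 0 ≤ F := Finset.sum_nonneg fun i _ => Finset.sum_nonneg fun j _ => sq_nonneg _
  refine ⟨F + 1, by positivity, PosDef.of_dotProduct_mulVec_pos ?_ fun x hx => ?_⟩
  · refine IsHermitian.sub ?_ isHermitian_one
    rw [IsHermitian, conjTranspose_smul, hM.1, star_trivial]
  · have hform : x ⬝ᵥ (M *ᵥ x) = (B *ᵥ x) ⬝ᵥ (B *ᵥ x) := by
      rw [hB, ← mulVec_mulVec, dotProduct_mulVec, vecMul_transpose]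
    have hxB : x = B⁻¹ *ᵥ (B *ᵥ x) := by
      rw [mulVec_mulVec, nonsing_inv_mul _ hBu, one_mulVec]
    have hle : x ⬝ᵥ x ≤ F * ((B *ᵥ x) ⬝ᵥ (B *ᵥ x)) := by
      nth_rw 1 2 [hxB]
      rw [hF, Finset.sum_mul]
      refine Finset.sum_le_sum fun i _ => ?_
      rw [← sq, mulVec, dotProduct]
      refine (Finset.sum_mul_sq_le_sq_mul_sq _ _ _).trans_eq ?_
      simp only [dotProduct, sq]
    have hpos : 0 < x ⬝ᵥ (M *ᵥ x) := by simpa using hM.dotProduct_mulVec_pos hx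
    rw [star_trivial, sub_mulVec, one_mulVec, dotProduct_sub, smul_mulVec, dotProduct_smul,
      smul_eq_mul]
    rw [← hform] at hle
    linarith

theorem one_sub_inv_posDef {M : Matrix ι ι ℝ} (hM : (M - 1).PosDef) : (1 - M⁻¹).PosDef := by
  have hMu : IsUnit M.det := by
    have : M = (M - 1) + 1 := by abel
    rw [this]
    exact isUnit_iff_ne_zero.2 (hM.add PosDef.one).det_pos.ne'
  have hPu : IsUnit (M - 1).det := isUnit_iff_ne_zero.2 hM.det_pos.ne'
  have h : (1 + (M - 1)⁻¹)⁻¹ = 1 - M⁻¹ := by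
    refine inv_eq_right_inv ?_
    have h1 : 1 + (M - 1)⁻¹ = (M - 1)⁻¹ * M := by
      nth_rw 3 [show M = (M - 1) + 1 by abel]
      rw [mul_add, nonsing_inv_mul _ hPu, mul_one]
    rw [h1, mul_assoc, mul_sub, mul_one, mul_nonsing_inv _ hMu, nonsing_inv_mul _ hPu]
  rw [← h]
  exact (PosDef.one.add hM.inv).inv

theorem det_one_add_mul_diagonal_mul_prod {M : Matrix ι ι ℝ} {c : ℝ} (hc : 0 < c)
    (hM : IsUnit (c • M).det) {t : ι → ℝ} (ht : ∀ i, 0 ≤ t i) :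
    (1 + M * diagonal t).det * ∏ i, c / (c + t i) =
      (c • M).det * (1 - (1 - (c • M)⁻¹) * diagonal fun i => c / (c + t i)).det := by
  rw [← det_diagonal, ← det_mul, ← det_mul]
  congr 1
  rw [mul_sub, mul_one, ← mul_assoc, mul_sub, mul_one, mul_nonsing_inv _ hM]
  ext i j
  have : 0 < c + t j := add_pos_of_pos_of_nonneg hc (ht j)
  rw [Matrix.sub_apply, mul_diagonal, mul_diagonal, Matrix.add_apply, Matrix.sub_apply,
    mul_diagonal, Matrix.smul_apply, smul_eq_mul]
  field_simp
  ring

end PrincipalMinor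

section ScaledBlocks

variable {m n : Type}

/-- The block matrix with off-diagonal blocks multiplied by `τ`. -/
def scaledBlocks (A : Matrix m m ℝ) (B : Matrix m n ℝ) (D : Matrix n n ℝ) (τ : ℝ) :
    Matrix (m ⊕ n) (m ⊕ n) ℝ :=
  fromBlocks A (τ • B) (τ • Bᵀ) D

theorem scaledBlocks_one (A : Matrix m m ℝ) (B : Matrix m n ℝ) (D : Matrix n n ℝ) :
    scaledBlocks A B D 1 = fromBlocks A B Bᵀ D := by
  rw [scaledBlocks, one_smul, one_smul]

variable [DecidableEq m] [DecidableEq n]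

theorem smul_scaledBlocks_sub_one (A : Matrix m m ℝ) (B : Matrix m n ℝ) (D : Matrix n n ℝ)
    (c τ : ℝ) : c • scaledBlocks A B D τ - 1 = scaledBlocks (c • A - 1) (c • B) (c • D - 1) τ := by
  rw [scaledBlocks, scaledBlocks, fromBlocks_smul, ← fromBlocks_one, sub_eq_add_neg,
    fromBlocks_neg, fromBlocks_add]
  simp [sub_eq_add_neg, smul_smul, mul_comm]

variable {A : Matrix m m ℝ} {B : Matrix m n ℝ} {D : Matrix n n ℝ}

theorem principalMinor_scaledBlocks_pair (i : m) (j : n) (τ : ℝ) :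
    principalMinor (scaledBlocks A B D τ) {Sum.inl i, Sum.inr j} =
      A i i * D j j - τ ^ 2 * B i j ^ 2 := by
  let f : Fin 2 → ({Sum.inl i, Sum.inr j} : Finset (m ⊕ n)) :=
    ![⟨Sum.inl i, by simp⟩, ⟨Sum.inr j, by simp⟩]
  have hf : Function.Bijective f := by
    constructor
    · intro a b hab
      fin_cases a <;> fin_cases b <;> simp_all [f]
    · rintro ⟨x, hx⟩
      rcases Finset.mem_insert.1 hx with rfl | hx
      · exact ⟨0, rfl⟩
      · obtain rfl := Finset.mem_singleton.1 hx
        exact ⟨1, rfl⟩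
  rw [principalMinor, ← det_submatrix_equiv_self (Equiv.ofBijective f hf), det_fin_two]
  simp [f, scaledBlocks]
  ring

theorem differentiable_principalMinor_scaledBlocks (J : Finset (m ⊕ n)) :
    Differentiable ℝ fun τ => principalMinor (scaledBlocks A B D τ) J := by
  have hent : ∀ i j, Differentiable ℝ fun τ => scaledBlocks A B D τ i j := by
    intro i j
    rcases i with i | i <;> rcases j with j | j <;> simp only [scaledBlocks, fromBlocks_apply₁₁,
      fromBlocks_apply₁₂, fromBlocks_apply₂₁, fromBlocks_apply₂₂, Matrix.smul_apply] <;> fun_prop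
  simp only [principalMinor, det_apply]
  refine Differentiable.fun_sum fun σ _ => Differentiable.const_smul ?_ _
  exact Differentiable.fun_finsetProd fun i _ => hent _ _

variable [Fintype m] [Fintype n]

theorem scaledBlocks_posDef {m n : Type} [Fintype m] [Fintype n] {A : Matrix m m ℝ}
    {B : Matrix m n ℝ} {D : Matrix n n ℝ} (h : (fromBlocks A B Bᵀ D).PosDef) {τ : ℝ}
    (hτ : τ ∈ Set.Icc (0 : ℝ) 1) : (scaledBlocks A B D τ).PosDef := by
  have hH := isHermitian_fromBlocks_iff.1 h.1
  refine PosDef.of_dotProduct_mulVec_pos (isHermitian_fromBlocks_iff.2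
    ⟨hH.1, ?_, ?_, hH.2.2.2⟩) fun x hx => ?_
  · simp
  · simp
  · obtain ⟨⟨x₁, x₂⟩, rfl⟩ := (Equiv.sumArrowEquivProdArrow m n ℝ).symm.surjective x
    change Sum.elim x₁ x₂ ≠ 0 at hx
    change 0 < star (Sum.elim x₁ x₂) ⬝ᵥ (scaledBlocks A B D τ *ᵥ Sum.elim x₁ x₂)
    have hx' : Sum.elim (-x₁) x₂ ≠ 0 := fun h0 => hx <| funext fun i => by
      rcases i with i | i
      · simpa using congrFun h0 (Sum.inl i)
      · exact congrFun h0 (Sum.inr i)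
    have h1 := h.dotProduct_mulVec_pos hx
    have h2 := h.dotProduct_mulVec_pos hx'
    simp only [star_trivial, scaledBlocks, fromBlocks_mulVec, Sum.elim_comp_inl,
      Sum.elim_comp_inr, sumElim_dotProduct_sumElim, dotProduct_add, mulVec_neg, dotProduct_neg,
      neg_dotProduct, smul_mulVec, dotProduct_smul, smul_eq_mul, neg_neg] at h1 h2 ⊢
    nlinarith [mul_nonneg hτ.1 h1.le, hτ.1, hτ.2, mul_nonneg (sub_nonneg.2 hτ.2) h2.le]

theorem det_scaledBlocks_antitoneOn (h : (fromBlocks A B Bᵀ D).PosDef) :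
    AntitoneOn (fun τ => (scaledBlocks A B D τ).det) (Set.Icc 0 1) := by
  have hA : A.PosDef := by
    have := h.submatrix (e := (Sum.inl : m → m ⊕ n)) Sum.inl_injective
    exact this
  have := hA.isUnit.invertible
  have hdet : ∀ τ, (scaledBlocks A B D τ).det = A.det * (D - τ ^ 2 • (Bᵀ * A⁻¹ * B)).det := by
    intro τ
    rw [scaledBlocks, det_fromBlocks₁₁, invOf_eq_nonsing_inv]
    simp only [Matrix.smul_mul, Matrix.mul_smul, smul_smul, sq]
  have hR : (Bᵀ * A⁻¹ * B).PosSemidef := by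
    have := hA.inv.posSemidef.conjTranspose_mul_mul_same B
    rwa [conjTranspose_eq_transpose_of_trivial] at this
  have hDR : (D - Bᵀ * A⁻¹ * B).PosSemidef := by
    have := (PosDef.fromBlocks₁₁ B D hA).1
      (by rw [conjTranspose_eq_transpose_of_trivial]; exact h.posSemidef)
    rwa [conjTranspose_eq_transpose_of_trivial] at this
  intro σ hσ τ hτ hστ
  simp only [hdet]
  refine mul_le_mul_of_nonneg_left ?_ hA.det_pos.le
  have hX : (D - τ ^ 2 • (Bᵀ * A⁻¹ * B)).PosSemidef := by
    have : D - τ ^ 2 • (Bᵀ * A⁻¹ * B) =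
        (D - Bᵀ * A⁻¹ * B) + (1 - τ ^ 2) • (Bᵀ * A⁻¹ * B) := by
      rw [sub_smul, one_smul]
      abel
    rw [this]
    exact hDR.add (hR.smul (by nlinarith [hτ.1, hτ.2]))
  have hY : ((τ ^ 2 - σ ^ 2) • (Bᵀ * A⁻¹ * B)).PosSemidef :=
    hR.smul (by nlinarith [hσ.1, hτ.1])
  refine (det_le_det_add hX hY).trans_eq ?_
  congr 1
  rw [sub_smul]
  abel

theorem principalMinor_scaledBlocks_antitoneOn (h : (fromBlocks A B Bᵀ D).PosDef)
    (J : Finset (m ⊕ n)) :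
    AntitoneOn (fun τ => principalMinor (scaledBlocks A B D τ) J) (Set.Icc 0 1) := by
  let e : J ≃ {a // Sum.inl a ∈ J} ⊕ {b // Sum.inr b ∈ J} := Equiv.subtypeSum
  have hsub : ∀ τ, (scaledBlocks A B D τ).submatrix (Subtype.val ∘ e.symm) (Subtype.val ∘ e.symm) =
      scaledBlocks (A.submatrix Subtype.val Subtype.val) (B.submatrix Subtype.val Subtype.val)
        (D.submatrix Subtype.val Subtype.val) τ := by
    intro τ
    ext i j
    rcases i with i | i <;> rcases j with j | j <;> rfl
  have hpd := h.submatrix (Subtype.val_injective.comp e.symm.injective)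
  rw [← scaledBlocks_one, hsub, scaledBlocks_one] at hpd
  refine (det_scaledBlocks_antitoneOn hpd).congr fun τ _ => ?_
  simp only
  rw [← hsub, principalMinor, ← det_submatrix_equiv_self e.symm, submatrix_submatrix]

end ScaledBlocks

section PolyFunctional

open Polynomial

theorem integral_gammaMeasure (a c : ℝ) (ha : 0 < a) (hc : 0 < c) (g : ℝ → ℝ) :
    ∫ y, g y ∂(ProbabilityTheory.gammaMeasure a c) =
      ∫ y in Set.Ioi 0, c ^ a / Real.Gamma a * y ^ (a - 1) * Real.exp (-(c * y)) * g y := by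
  rw [ProbabilityTheory.gammaMeasure, integral_withDensity_eq_integral_toReal_smul
    (f := ProbabilityTheory.gammaPDF a c)
    (ProbabilityTheory.measurable_gammaPDFReal a c).ennreal_ofReal
    (Filter.Eventually.of_forall fun _ => ENNReal.ofReal_lt_top)]
  simp only [ProbabilityTheory.gammaPDF, smul_eq_mul,
    ENNReal.toReal_ofReal (ProbabilityTheory.gammaPDFReal_nonneg ha hc _)]
  rw [← integral_Ici_eq_integral_Ioi, ← setIntegral_eq_integral_of_forall_compl_eq_zero
    (s := Set.Ici 0)]
  · refine setIntegral_congr_fun measurableSet_Ici fun y hy => ?_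
    have hy' : (0 : ℝ) ≤ y := hy
    simp only [ProbabilityTheory.gammaPDFReal, if_pos hy']
  · intro y hy
    have hy' : ¬ (0 : ℝ) ≤ y := hy
    simp only [ProbabilityTheory.gammaPDFReal, if_neg hy', zero_mul]

theorem integral_exp_gammaMeasure {a c s : ℝ} (ha : 0 < a) (hc : 0 < c) (hs : 0 ≤ s) :
    ∫ y, Real.exp (-(s * y)) ∂(ProbabilityTheory.gammaMeasure a c) = (c / (c + s)) ^ a := by
  have hcs : 0 < c + s := by linarith
  have hG := Real.Gamma_pos_of_pos ha
  rw [integral_gammaMeasure a c ha hc]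
  have : ∀ y : ℝ, c ^ a / Real.Gamma a * y ^ (a - 1) * Real.exp (-(c * y)) * Real.exp (-(s * y)) =
      c ^ a / Real.Gamma a * (y ^ (a - 1) * Real.exp (-((c + s) * y))) := by
    intro y
    rw [mul_assoc, ← Real.exp_add, mul_assoc]
    ring_nf
  simp_rw [this]
  rw [integral_const_mul, Real.integral_rpow_mul_exp_neg_mul_Ioi ha hcs,
    Real.div_rpow zero_le_one hcs.le, Real.one_rpow, Real.div_rpow hc.le hcs.le]
  field_simp

theorem ae_nonneg_gammaMeasure (a c : ℝ) :
    ∀ᵐ y ∂(ProbabilityTheory.gammaMeasure a c), 0 ≤ y := by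
  rw [ae_iff]
  have : {y : ℝ | ¬ 0 ≤ y} = Set.Iio 0 := by ext; simp
  rw [this, ProbabilityTheory.gammaMeasure, withDensity_apply _ measurableSet_Iio]
  exact ProbabilityTheory.lintegral_gammaPDF_of_nonpos le_rfl

theorem exp_neg_mem_Icc {y : ℝ} (hy : 0 ≤ y) : Real.exp (-y) ∈ Set.Icc (0 : ℝ) 1 :=
  ⟨(Real.exp_pos _).le, Real.exp_le_one_iff.2 (neg_nonpos.2 hy)⟩

theorem exp_neg_natCast_mul (k : ℕ) (y : ℝ) : Real.exp (-(k * y)) = Real.exp (-y) ^ k := by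
  rw [← Real.exp_nat_mul]
  ring_nf

theorem sum_coeff_mul_exp {D : ℕ} {q : ℝ[X]} (hq : q.natDegree < D) (y : ℝ) :
    ∑ k : Fin D, q.coeff k * Real.exp (-((k : ℕ) * y)) = q.eval (Real.exp (-y)) := by
  rw [eval_eq_sum_range' hq, ← Fin.sum_univ_eq_sum_range fun k => q.coeff k * Real.exp (-y) ^ k]
  exact Finset.sum_congr rfl fun k _ => by rw [exp_neg_natCast_mul]

/-- The mean of `q (exp (-Y))` for a gamma distributed `Y` with shape `a` and rate `c`. -/
noncomputable def gammaMean (c a : ℝ) (q : ℝ[X]) : ℝ :=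
  ∫ y, q.eval (Real.exp (-y)) ∂(ProbabilityTheory.gammaMeasure a c)

theorem gammaMean_nonneg (c a : ℝ) {q : ℝ[X]} (hq : ∀ s ∈ Set.Icc (0 : ℝ) 1, 0 ≤ q.eval s) :
    0 ≤ gammaMean c a q :=
  integral_nonneg_of_ae <| (ae_nonneg_gammaMeasure a c).mono fun _ hy => hq _ (exp_neg_mem_Icc hy)

theorem sum_coeff_mul_rpow {c a : ℝ} (ha : 0 < a) (hc : 0 < c) {D : ℕ} {q : ℝ[X]}
    (hq : q.natDegree < D) :
    ∑ k : Fin D, q.coeff k * (c / (c + (k : ℕ))) ^ a = gammaMean c a q := by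
  have := ProbabilityTheory.isProbabilityMeasure_gammaMeasure ha hc
  have hint : ∀ k : Fin D, Integrable (fun y => Real.exp (-((k : ℕ) * y)))
      (ProbabilityTheory.gammaMeasure a c) := fun k => by
    by_contra h
    have h1 := integral_exp_gammaMeasure ha hc (Nat.cast_nonneg (k : ℕ))
    rw [integral_undef h] at h1
    have : 0 < c / (c + (k : ℕ)) := by positivity
    exact (Real.rpow_pos_of_pos this a).ne h1
  rw [gammaMean]
  simp_rw [← sum_coeff_mul_exp hq]
  rw [integral_finsetSum _ fun k _ => (hint k).const_mul _]
  refine Finset.sum_congr rfl fun k _ => ?_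
  rw [integral_const_mul, integral_exp_gammaMeasure ha hc (Nat.cast_nonneg _)]

variable {ι : Type} [Fintype ι] [DecidableEq ι]

/-- The signed combination of evaluations of `f` at natural number points whose weights are the
products of the coefficients of the polynomials `q i`. -/
noncomputable def polyFunctional (D : ℕ) (q : ι → ℝ[X]) (f : (ι → ℝ) → ℝ) : ℝ :=
  ∑ k : ι → Fin D, (∏ i, (q i).coeff (k i)) * f fun i => ((k i : ℕ) : ℝ)

theorem polyFunctional_prod (D : ℕ) (q : ι → ℝ[X]) (f : ι → ℝ → ℝ) :
    polyFunctional D q (fun t => ∏ i, f i (t i)) =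
      ∏ i, ∑ k : Fin D, (q i).coeff k * f i (k : ℕ) := by
  rw [Finset.prod_univ_sum, Fintype.piFinset_univ, polyFunctional]
  exact Finset.sum_congr rfl fun k _ => Finset.prod_mul_distrib.symm

theorem polyFunctional_laplace {Ω : Type*} [MeasurableSpace Ω] (ν : Measure Ω) [IsFiniteMeasure ν]
    {X : Ω → ι → ℝ} (hX : Measurable X) (hpos : ∀ᵐ ω ∂ν, ∀ i, 0 ≤ X ω i) {D : ℕ} {q : ι → ℝ[X]}
    (hq : ∀ i, (q i).natDegree < D) :
    polyFunctional D q (fun t => ∫ ω, Real.exp (-∑ i, t i * X ω i) ∂ν) =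
      ∫ ω, ∏ i, (q i).eval (Real.exp (-X ω i)) ∂ν := by
  have hint : ∀ k : ι → Fin D,
      Integrable (fun ω => Real.exp (-∑ i, ((k i : ℕ) : ℝ) * X ω i)) ν := by
    intro k
    refine Integrable.of_bound (C := 1) (Measurable.aestronglyMeasurable ?_) ?_
    · refine (Finset.measurable_fun_sum _ fun i _ => ?_).neg.exp
      exact ((measurable_pi_apply i).comp hX).const_mul _
    · refine hpos.mono fun ω h => ?_
      rw [Real.norm_eq_abs, abs_of_pos (Real.exp_pos _), Real.exp_le_one_iff, neg_nonpos]
      exact Finset.sum_nonneg fun i _ => mul_nonneg (Nat.cast_nonneg _) (h i)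
  have h1 : ∀ ω, ∏ i, (q i).eval (Real.exp (-X ω i)) =
      polyFunctional D q fun t => Real.exp (-∑ i, t i * X ω i) := by
    intro ω
    have : (fun t : ι → ℝ => Real.exp (-∑ i, t i * X ω i)) =
        fun t => ∏ i, Real.exp (-(t i * X ω i)) := by
      ext t
      rw [← Real.exp_sum, Finset.sum_neg_distrib]
    rw [this, polyFunctional_prod D q fun i s => Real.exp (-(s * X ω i))]
    exact Finset.prod_congr rfl fun i _ => (sum_coeff_mul_exp (hq i) _).symm
  simp_rw [h1, polyFunctional]
  rw [integral_finsetSum _ fun k _ => (hint k).const_mul _]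
  exact Finset.sum_congr rfl fun k _ => by rw [integral_const_mul]

theorem le_polyFunctional_det_rpow {M : Matrix ι ι ℝ} (hM : M.PosSemidef) {c : ℝ} (hc : 0 < c)
    (hcM : (c • M - 1).PosDef) {β : ℝ} (hβ : 0 < β)
    (hN : (∃ n : ℕ, 2 * β = n) ∨ (Fintype.card ι : ℝ) ≤ 2 * (2 * β)) {D : ℕ} {q : ι → ℝ[X]}
    (hD : ∀ i, (q i).natDegree < D) (hq : ∀ i, ∀ s ∈ Set.Icc (0 : ℝ) 1, 0 ≤ (q i).eval s) :
    (c • M).det ^ (-β) * ∏ i, gammaMean c β (q i) ≤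
      polyFunctional D q fun t => (1 + M * diagonal t).det ^ (-β) := by
  have hcM' : (c • M).PosDef := by
    have := hcM.add PosDef.one
    rwa [sub_add_cancel] at this
  have hA := one_sub_inv_posDef hcM
  have hA1 : (1 - (1 - (c • M)⁻¹)).PosDef := by
    rw [sub_sub_cancel]
    exact hcM'.inv
  have hmono := absMono_det_rpow hA hA1 hN
  set A := 1 - (c • M)⁻¹ with hAdef
  have hdet := hcM'.det_pos
  let u : (ι → ℝ) → ι → ℝ := fun t i => c / (c + t i)
  have hu : ∀ k : ι → Fin D, ∀ i, u (fun i => ((k i : ℕ) : ℝ)) i ∈ Set.Icc (0 : ℝ) 1 := by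
    intro k i
    have : (0 : ℝ) ≤ (k i : ℕ) := Nat.cast_nonneg _
    have h2 : 0 < c + (k i : ℕ) := by positivity
    exact ⟨by positivity, (div_le_one h2).2 (by linarith)⟩
  have hu0 : ∀ k : ι → Fin D, ∀ i, 0 < u (fun i => ((k i : ℕ) : ℝ)) i := by
    intro k i
    positivity
  have hexp : ∀ k : ι → Fin D,
      (1 + M * diagonal fun i => ((k i : ℕ) : ℝ)).det ^ (-β) = (c • M).det ^ (-β) *
        ((∏ i, u (fun i => ((k i : ℕ) : ℝ)) i ^ β) *
          (1 - A * diagonal (u fun i => ((k i : ℕ) : ℝ))).det ^ (-β)) := by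
    intro k
    set t : ι → ℝ := fun i => ((k i : ℕ) : ℝ) with ht
    have ht0 : ∀ i, 0 ≤ t i := fun i => Nat.cast_nonneg _
    have h1 := det_one_add_mul_diagonal_mul_prod hc (isUnit_iff_ne_zero.2 hdet.ne') ht0
    have hp : 0 < ∏ i, u t i := Finset.prod_pos fun i _ => hu0 k i
    have hd := det_one_sub_mul_diagonal_pos hA1 (hu k)
    have hF : 0 < (1 + M * diagonal t).det :=
      one_pos.trans_le (det_one_add_mul_diagonal_pos hM ht0)
    have h2 : (1 + M * diagonal t).det ^ (-β) * (∏ i, u t i) ^ (-β) =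
        (c • M).det ^ (-β) * (1 - A * diagonal (u t)).det ^ (-β) := by
      rw [← Real.mul_rpow hF.le hp.le, ← Real.mul_rpow hdet.le hd.le, h1]
    have h3 : (∏ i, u t i) ^ (-β) * ∏ i, u t i ^ β = 1 := by
      rw [Real.finsetProd_rpow _ _ fun i _ => (hu0 k i).le, ← Real.rpow_add hp, neg_add_cancel,
        Real.rpow_zero]
    calc _ = (1 + M * diagonal t).det ^ (-β) * ((∏ i, u t i) ^ (-β) * ∏ i, u t i ^ β) := by
          rw [h3, mul_one]
      _ = (1 + M * diagonal t).det ^ (-β) * (∏ i, u t i) ^ (-β) * ∏ i, u t i ^ β := by ring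
      _ = _ := by rw [h2]; ring
  have key := hmono (Option (ι → Fin D))
    (fun o => o.elim (-∏ i, gammaMean c β (q i)) fun k =>
      (∏ i, (q i).coeff (k i)) * ∏ i, u (fun i => ((k i : ℕ) : ℝ)) i ^ β)
    (fun o => o.elim 0 fun k => u fun i => ((k i : ℕ) : ℝ)) (by
      rintro (_ | k) i
      · exact ⟨le_rfl, zero_le_one⟩
      · exact hu k i) (by
      intro n
      rw [Fintype.sum_option]
      simp only [Option.elim_none, Option.elim_some, Pi.zero_apply]
      have h1 : ∑ k : ι → Fin D, ((∏ i, (q i).coeff (k i)) *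
          ∏ i, u (fun i => ((k i : ℕ) : ℝ)) i ^ β) * ∏ i, u (fun i => ((k i : ℕ) : ℝ)) i ^ n i =
          ∏ i, gammaMean c (β + n i) (q i) := by
        have h2 := polyFunctional_prod D q fun i s => (c / (c + s)) ^ (β + n i)
        rw [Finset.prod_congr rfl fun i _ => sum_coeff_mul_rpow
          (show 0 < β + n i by positivity) hc (hD i)] at h2
        rw [← h2, polyFunctional]
        refine Finset.sum_congr rfl fun k _ => ?_
        rw [mul_assoc, ← Finset.prod_mul_distrib]
        congr 1
        refine Finset.prod_congr rfl fun i _ => ?_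
        rw [Real.rpow_add (hu0 k i), Real.rpow_natCast]
      rw [h1]
      by_cases hn : n = 0
      · subst hn
        simp
      · obtain ⟨i, hi⟩ := Function.ne_iff.1 hn
        have h0 : ∏ i, (0 : ℝ) ^ n i = 0 := Finset.prod_eq_zero (Finset.mem_univ i) (zero_pow hi)
        rw [h0, mul_zero, zero_add]
        exact Finset.prod_nonneg fun i _ => gammaMean_nonneg _ _ (hq i))
  rw [Fintype.sum_option] at key
  simp only [Option.elim_none, Option.elim_some] at key
  have h0 : (diagonal (0 : ι → ℝ)) = 0 := diagonal_zero
  rw [h0, mul_zero, sub_zero, det_one, Real.one_rpow, mul_one, neg_add_eq_sub, sub_nonneg] at key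
  have hβ2 : 2 * β / 2 = β := by ring
  rw [hβ2] at key
  refine (mul_le_mul_of_nonneg_left key (Real.rpow_nonneg hdet.le (-β))).trans_eq ?_
  rw [Finset.mul_sum, polyFunctional]
  refine Finset.sum_congr rfl fun k _ => ?_
  rw [hexp]
  ring

/-- Multiplication of `f` by the coordinates in `J` corresponds to applying `X * d/dX` to the
polynomials with index in `J`. -/
noncomputable def eulerOn (J : Finset ι) (q : ι → ℝ[X]) (i : ι) : ℝ[X] :=
  if i ∈ J then X * derivative (q i) else q i

theorem coeff_X_mul_derivative (p : ℝ[X]) (k : ℕ) :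
    (X * derivative p).coeff k = k * p.coeff k := by
  rcases k with _ | k
  · simp
  · rw [coeff_X_mul, coeff_derivative]
    push_cast
    ring

theorem natDegree_eulerOn_lt {ι : Type} [DecidableEq ι] {D : ℕ} {q : ι → ℝ[X]}
    (hD : ∀ i, (q i).natDegree < D) (J : Finset ι) (i : ι) : (eulerOn J q i).natDegree < D := by
  rw [eulerOn]
  split_ifs
  · refine lt_of_le_of_lt ?_ (hD i)
    rw [natDegree_le_iff_coeff_eq_zero]
    intro k hk
    rw [coeff_X_mul_derivative, coeff_eq_zero_of_natDegree_lt hk, mul_zero]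
  · exact hD i

theorem eulerOn_eval_nonneg {ι : Type} [DecidableEq ι] {q : ι → ℝ[X]}
    (hq : ∀ i, ∀ s ∈ Set.Icc (0 : ℝ) 1, 0 ≤ (q i).eval s)
    (hq' : ∀ i, ∀ s ∈ Set.Icc (0 : ℝ) 1, 0 ≤ (derivative (q i)).eval s) (J : Finset ι) (i : ι) :
    ∀ s ∈ Set.Icc (0 : ℝ) 1, 0 ≤ (eulerOn J q i).eval s := by
  intro s hs
  rw [eulerOn]
  split_ifs
  · rw [eval_mul, eval_X]
    exact mul_nonneg hs.1 (hq' i s hs)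
  · exact hq i s hs

theorem polyFunctional_prod_mul (D : ℕ) (q : ι → ℝ[X]) (J : Finset ι) (f : (ι → ℝ) → ℝ) :
    polyFunctional D q (fun t => (∏ j ∈ J, t j) * f t) = polyFunctional D (eulerOn J q) f := by
  rw [polyFunctional, polyFunctional]
  refine Finset.sum_congr rfl fun k _ => ?_
  rw [← mul_assoc]
  congr 1
  rw [← Finset.prod_mul_prod_compl J, ← Finset.prod_mul_prod_compl J fun i =>
    (eulerOn J q i).coeff (k i)]
  have h1 : ∏ i ∈ J, (eulerOn J q i).coeff (k i) =
      ∏ i ∈ J, (((k i : ℕ) : ℝ) * (q i).coeff (k i)) :=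
    Finset.prod_congr rfl fun i hi => by rw [eulerOn, if_pos hi, coeff_X_mul_derivative]
  have h2 : ∏ i ∈ Jᶜ, (eulerOn J q i).coeff (k i) = ∏ i ∈ Jᶜ, (q i).coeff (k i) :=
    Finset.prod_congr rfl fun i hi => by rw [eulerOn, if_neg (Finset.mem_compl.1 hi)]
  rw [h1, h2, Finset.prod_mul_distrib]
  ring

end PolyFunctional

section Cutoff

open Polynomial Filter Topology

/-- Polynomials, increasing on `[0, 1]`, for which `y ↦ (cutoff x n) (exp (-y))` approximates the
indicator function of `[0, x]` as `n` tends to infinity. -/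
noncomputable def cutoff (x : ℝ) (n : ℕ) : ℝ[X] :=
  1 - (1 - X ^ n) ^ ⌈n * Real.exp (n * x)⌉₊

theorem eval_cutoff (x : ℝ) (n : ℕ) (s : ℝ) :
    (cutoff x n).eval s = 1 - (1 - s ^ n) ^ ⌈n * Real.exp (n * x)⌉₊ := by
  simp [cutoff]

theorem cutoff_eval_mem_Icc (x : ℝ) (n : ℕ) {s : ℝ} (hs : s ∈ Set.Icc (0 : ℝ) 1) :
    (cutoff x n).eval s ∈ Set.Icc (0 : ℝ) 1 := by
  rw [eval_cutoff]
  have h0 : 0 ≤ s ^ n := pow_nonneg hs.1 n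
  have h1 : s ^ n ≤ 1 := pow_le_one₀ hs.1 hs.2
  have h2 : 0 ≤ (1 - s ^ n) ^ ⌈n * Real.exp (n * x)⌉₊ := pow_nonneg (by linarith) _
  have h3 : (1 - s ^ n) ^ ⌈n * Real.exp (n * x)⌉₊ ≤ 1 := pow_le_one₀ (by linarith) (by linarith)
  constructor <;> linarith

theorem derivative_cutoff_eval_nonneg (x : ℝ) (n : ℕ) {s : ℝ} (hs : s ∈ Set.Icc (0 : ℝ) 1) :
    0 ≤ (derivative (cutoff x n)).eval s := by
  have h0 : 0 ≤ s ^ (n - 1) := pow_nonneg hs.1 _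
  have h1 : s ^ n ≤ 1 := pow_le_one₀ hs.1 hs.2
  have h2 : 0 ≤ (1 - s ^ n) ^ (⌈n * Real.exp (n * x)⌉₊ - 1) := pow_nonneg (by linarith) _
  have h3 : (derivative (cutoff x n)).eval s = (⌈n * Real.exp (n * x)⌉₊ : ℝ) *
      (1 - s ^ n) ^ (⌈n * Real.exp (n * x)⌉₊ - 1) * (n * s ^ (n - 1)) := by
    simp [cutoff, derivative_pow]
  rw [h3]
  exact mul_nonneg (mul_nonneg (Nat.cast_nonneg _) h2) (mul_nonneg (Nat.cast_nonneg _) h0)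

theorem tendsto_cutoff {x : ℝ} (hx : 0 < x) {y : ℝ} (hy : 0 ≤ y) :
    Tendsto (fun n => (cutoff x n).eval (Real.exp (-y))) atTop
      (𝓝 ((Set.Icc 0 x).indicator 1 y)) := by
  have hexp : ∀ n : ℕ, Real.exp (-y) ^ n = Real.exp (-(n * y)) := fun n =>
    (exp_neg_natCast_mul n y).symm
  have hmem : ∀ n : ℕ, (cutoff x n).eval (Real.exp (-y)) ∈ Set.Icc (0 : ℝ) 1 := fun n =>
    cutoff_eval_mem_Icc x n (exp_neg_mem_Icc hy)
  rcases le_or_gt y x with hyx | hyx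
  · rw [Set.indicator_of_mem (show y ∈ Set.Icc 0 x from ⟨hy, hyx⟩), Pi.one_apply]
    have h1 : Tendsto (fun n : ℕ => 1 - Real.exp (-(n : ℝ))) atTop (𝓝 (1 - 0)) :=
      tendsto_const_nhds.sub
        (Real.tendsto_exp_neg_atTop_nhds_zero.comp tendsto_natCast_atTop_atTop)
    rw [sub_zero] at h1
    refine tendsto_of_tendsto_of_tendsto_of_le_of_le h1 tendsto_const_nhds (fun n => ?_)
      fun n => (hmem n).2
    simp only [eval_cutoff, hexp]
    refine sub_le_sub_left ?_ 1
    have h2 : Real.exp (-(n * y)) ≤ 1 := Real.exp_le_one_iff.2 (by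
      rw [neg_nonpos]; positivity)
    refine (pow_le_pow_left₀ (by linarith) (Real.one_sub_le_exp_neg _) _).trans ?_
    rw [← Real.exp_nat_mul, Real.exp_le_exp, mul_neg, neg_le_neg_iff]
    calc (n : ℝ) ≤ n * Real.exp (n * x) * Real.exp (-(n * y)) := by
          rw [mul_assoc, ← Real.exp_add]
          refine le_mul_of_one_le_right (Nat.cast_nonneg n) (Real.one_le_exp ?_)
          have : 0 ≤ (n : ℝ) * (x - y) := mul_nonneg (Nat.cast_nonneg n) (sub_nonneg.2 hyx)
          linarith
      _ ≤ _ := mul_le_mul_of_nonneg_right (Nat.le_ceil _) (Real.exp_pos _).le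
  · rw [Set.indicator_of_notMem (fun h => absurd h.2 (not_le.2 hyx))]
    have h1 : Tendsto (fun n : ℕ => (n : ℝ) * Real.exp (-(y - x)) ^ n) atTop (𝓝 0) :=
      tendsto_self_mul_const_pow_of_lt_one (Real.exp_pos _).le
        (Real.exp_lt_one_iff.2 (by linarith))
    have h2 : Tendsto (fun n : ℕ => Real.exp (-y) ^ n) atTop (𝓝 0) :=
      tendsto_pow_atTop_nhds_zero_of_lt_one (Real.exp_pos _).le
        (Real.exp_lt_one_iff.2 (by linarith))
    have h3 := h1.add h2
    rw [add_zero] at h3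
    refine tendsto_of_tendsto_of_tendsto_of_le_of_le tendsto_const_nhds h3
      (fun n => (hmem n).1) fun n => ?_
    simp only [eval_cutoff]
    have h4 : Real.exp (-y) ^ n ≤ 1 := pow_le_one₀ (Real.exp_pos _).le (exp_neg_mem_Icc hy).2
    have h5 := one_add_mul_le_pow (a := -Real.exp (-y) ^ n) (by linarith)
      ⌈n * Real.exp (n * x)⌉₊
    rw [← sub_eq_add_neg] at h5
    have h6 : ((⌈n * Real.exp (n * x)⌉₊ : ℕ) : ℝ) * Real.exp (-y) ^ n ≤
        (n * Real.exp (n * x) + 1) * Real.exp (-y) ^ n :=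
      mul_le_mul_of_nonneg_right (Nat.ceil_lt_add_one (by positivity)).le (by positivity)
    have h7 : Real.exp (-(y - x)) ^ n = Real.exp (n * x) * Real.exp (-y) ^ n := by
      rw [Real.exp_nat_mul, ← mul_pow, ← Real.exp_add]
      ring_nf
    rw [h7]
    linarith

variable {ι : Type} [Fintype ι]

theorem tendsto_integral_prod_cutoff {x : ι → ℝ} (hx : ∀ i, 0 < x i) {Ω : Type*}
    [MeasurableSpace Ω] (ν : Measure Ω) [IsFiniteMeasure ν] {Y : Ω → ι → ℝ} (hY : Measurable Y)
    (hpos : ∀ᵐ ω ∂ν, ∀ i, 0 ≤ Y ω i) :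
    Tendsto (fun n => ∫ ω, ∏ i, (cutoff (x i) n).eval (Real.exp (-Y ω i)) ∂ν) atTop
      (𝓝 (ν.real (Y ⁻¹' Set.univ.pi fun i => Set.Icc 0 (x i)))) := by
  have hmeas : MeasurableSet (Y ⁻¹' Set.univ.pi fun i => Set.Icc 0 (x i)) :=
    hY (MeasurableSet.univ_pi fun i => measurableSet_Icc)
  rw [← integral_indicator_one hmeas]
  refine tendsto_integral_of_dominated_convergence (fun _ => 1) (fun n => ?_)
    (integrable_const 1) (fun n => ?_) ?_
  · refine (Finset.measurable_fun_prod _ fun i _ => ?_).aestronglyMeasurable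
    exact (cutoff (x i) n).continuous.measurable.comp
      (((measurable_pi_apply i).comp hY).neg.exp)
  · refine hpos.mono fun ω hω => ?_
    have h := fun i => cutoff_eval_mem_Icc (x i) n (exp_neg_mem_Icc (hω i))
    rw [Real.norm_eq_abs, abs_of_nonneg (Finset.prod_nonneg fun i _ => (h i).1)]
    exact Finset.prod_le_one (fun i _ => (h i).1) fun i _ => (h i).2
  · refine hpos.mono fun ω hω => ?_
    have h := tendsto_finsetProd Finset.univ fun i _ => tendsto_cutoff (hx i) (hω i)
    convert h using 2
    by_cases hω' : ω ∈ Y ⁻¹' Set.univ.pi fun i => Set.Icc 0 (x i)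
    · rw [Set.indicator_of_mem hω', Pi.one_apply]
      exact (Finset.prod_eq_one fun i _ => Set.indicator_of_mem (hω' i (Set.mem_univ i)) _).symm
    · rw [Set.indicator_of_notMem hω']
      simp only [Set.mem_preimage, Set.mem_univ_pi, not_forall] at hω'
      obtain ⟨i, hi⟩ := hω'
      exact (Finset.prod_eq_zero (Finset.mem_univ i) (Set.indicator_of_notMem hi _)).symm

theorem exists_smul_restrict_le_gammaMeasure {a c u v : ℝ} (ha : 0 < a) (hc : 0 < c) (hu : 0 < u) :
    ∃ C : ℝ, 0 < C ∧ ENNReal.ofReal C • volume.restrict (Set.Icc u v) ≤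
      ProbabilityTheory.gammaMeasure a c := by
  have hcont : ContinuousOn (ProbabilityTheory.gammaPDFReal a c) (Set.Icc u v) := by
    have h1 : ContinuousOn (fun y : ℝ => c ^ a / Real.Gamma a * y ^ (a - 1) * Real.exp (-(c * y)))
        (Set.Icc u v) := by
      refine ContinuousOn.mul (continuousOn_const.mul ?_) (by fun_prop)
      exact continuousOn_id.rpow_const fun y hy => Or.inl (hu.trans_le hy.1).ne'
    refine h1.congr fun y hy => ?_
    rw [ProbabilityTheory.gammaPDFReal, if_pos (hu.trans_le hy.1).le]
  obtain ⟨C, hC, hle⟩ : ∃ C : ℝ, 0 < C ∧ ∀ y ∈ Set.Icc u v,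
      C ≤ ProbabilityTheory.gammaPDFReal a c y := by
    rcases (Set.Icc u v).eq_empty_or_nonempty with he | hne
    · exact ⟨1, one_pos, by simp [he]⟩
    · obtain ⟨y, hy, hmin⟩ := isCompact_Icc.exists_isMinOn hne hcont
      exact ⟨_, ProbabilityTheory.gammaPDFReal_pos ha hc (hu.trans_le hy.1), fun z hz => hmin hz⟩
  refine ⟨C, hC, ?_⟩
  rw [← withDensity_const, ← withDensity_indicator measurableSet_Icc,
    ProbabilityTheory.gammaMeasure]
  refine withDensity_mono (Eventually.of_forall fun y => ?_)
  by_cases hy : y ∈ Set.Icc u v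
  · rw [Set.indicator_of_mem hy]
    exact ENNReal.ofReal_le_ofReal (hle y hy)
  · rw [Set.indicator_of_notMem hy]
    exact zero_le

theorem eventually_le_gammaMean_cutoff {a c x : ℝ} (ha : 0 < a) (hc : 0 < c) (hx : 0 < x) :
    ∃ δ : ℝ, 0 < δ ∧ ∀ᶠ n in atTop, δ ≤ gammaMean c a (cutoff x n) := by
  have := ProbabilityTheory.isProbabilityMeasure_gammaMeasure ha hc
  have hlim := tendsto_integral_prod_cutoff (ι := Unit) (x := fun _ => x) (fun _ => hx)
    (ProbabilityTheory.gammaMeasure a c) (Y := fun y _ => y)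
    (measurable_pi_lambda _ fun _ => measurable_id)
    ((ae_nonneg_gammaMeasure a c).mono fun y hy _ => hy)
  simp only [Finset.univ_unique, Finset.prod_singleton] at hlim
  set δ := (ProbabilityTheory.gammaMeasure a c).real
    ((fun y _ => y) ⁻¹' Set.univ.pi fun _ : Unit => Set.Icc 0 x) with hδ
  have hpos : 0 < δ := by
    obtain ⟨C, hC, hle⟩ := exists_smul_restrict_le_gammaMeasure (v := x) ha hc (half_pos hx)
    rw [hδ, measureReal_def, ENNReal.toReal_pos_iff]
    refine ⟨lt_of_lt_of_le ?_ (hle _), measure_lt_top _ _⟩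
    have hsub : Set.Icc (x / 2) x ⊆
        (fun y _ => y) ⁻¹' Set.univ.pi fun _ : Unit => Set.Icc 0 x :=
      fun y hy _ _ => ⟨(half_pos hx).le.trans hy.1, hy.2⟩
    rw [Measure.smul_apply, Measure.restrict_apply', Set.inter_eq_right.2 hsub, Real.volume_Icc,
      smul_eq_mul]
    · exact ENNReal.mul_pos (ENNReal.ofReal_pos.2 hC).ne'
        (ENNReal.ofReal_pos.2 (by linarith)).ne'
    · exact measurableSet_Icc
  exact ⟨δ / 2, half_pos hpos, (hlim.eventually_const_lt (half_lt_self hpos)).mono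
    fun n hn => hn.le⟩

theorem eventually_le_gammaMean_X_mul_derivative_cutoff {a c x : ℝ} (ha : 0 < a) (hc : 0 < c)
    (hx : 0 < x) :
    ∃ δ : ℝ, 0 < δ ∧ ∀ᶠ n in atTop, δ ≤ gammaMean c a (X * derivative (cutoff x n)) := by
  have := ProbabilityTheory.isProbabilityMeasure_gammaMeasure ha hc
  obtain ⟨C, hC, hle⟩ := exists_smul_restrict_le_gammaMeasure (v := 2 * x) ha hc (half_pos hx)
  have h1 := tendsto_cutoff hx (half_pos hx).le
  have h2 := tendsto_cutoff hx (y := 2 * x) (by positivity)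
  rw [Set.indicator_of_mem (show x / 2 ∈ Set.Icc 0 x from ⟨(half_pos hx).le, by linarith⟩),
    Pi.one_apply] at h1
  rw [Set.indicator_of_notMem (show 2 * x ∉ Set.Icc 0 x from fun h => by linarith [h.2])] at h2
  have h3 := (h1.sub h2).const_mul C
  rw [sub_zero, mul_one] at h3
  refine ⟨C / 2, half_pos hC, (h3.eventually_const_lt (half_lt_self hC)).mono
    fun n hn => hn.le.trans ?_⟩
  set r := X * derivative (cutoff x n) with hr
  have hcont : Continuous fun y : ℝ => r.eval (Real.exp (-y)) :=
    r.continuous.comp (Real.continuous_exp.comp continuous_neg)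
  have hftc : ∫ y in Set.Icc (x / 2) (2 * x), r.eval (Real.exp (-y)) =
      (cutoff x n).eval (Real.exp (-(x / 2))) - (cutoff x n).eval (Real.exp (-(2 * x))) := by
    rw [integral_Icc_eq_integral_Ioc, ← intervalIntegral.integral_of_le (by linarith)]
    have hd : ∀ y : ℝ, HasDerivAt (fun y => -(cutoff x n).eval (Real.exp (-y)))
        (r.eval (Real.exp (-y))) y := by
      intro y
      have h := (((cutoff x n).hasDerivAt (Real.exp (-y))).comp y
        ((hasDerivAt_neg y).exp)).neg
      refine h.congr_deriv ?_
      rw [hr, eval_mul, eval_X]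
      ring
    rw [intervalIntegral.integral_eq_sub_of_hasDerivAt (fun y _ => hd y)
      (hcont.intervalIntegrable _ _)]
    ring
  obtain ⟨b, hb⟩ := isCompact_Icc.exists_bound_of_continuousOn (s := Set.Icc (0 : ℝ) 1)
    r.continuous.continuousOn
  have hint : Integrable (fun y : ℝ => r.eval (Real.exp (-y)))
      (ProbabilityTheory.gammaMeasure a c) :=
    Integrable.of_bound hcont.aestronglyMeasurable (C := b)
      ((ae_nonneg_gammaMeasure a c).mono fun y hy => hb _ (exp_neg_mem_Icc hy))
  have hnonneg : ∀ᵐ y ∂(ProbabilityTheory.gammaMeasure a c), 0 ≤ r.eval (Real.exp (-y)) :=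
    (ae_nonneg_gammaMeasure a c).mono fun y hy => by
      rw [hr, eval_mul, eval_X]
      exact mul_nonneg (Real.exp_pos _).le (derivative_cutoff_eval_nonneg x n (exp_neg_mem_Icc hy))
  have := integral_mono_measure hle hnonneg hint
  rwa [integral_smul_measure, hftc, ENNReal.toReal_ofReal hC.le, smul_eq_mul] at this

variable [DecidableEq ι]

theorem eventually_le_prod_gammaMean_eulerOn_cutoff {a c : ℝ} (ha : 0 < a) (hc : 0 < c) {x : ι → ℝ}
    (hx : ∀ i, 0 < x i) (J : Finset ι) :
    ∃ δ : ℝ, 0 < δ ∧ ∀ᶠ n in atTop,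
      δ ≤ ∏ i, gammaMean c a (eulerOn J (fun i => cutoff (x i) n) i) := by
  have h : ∀ i, ∃ δ : ℝ, 0 < δ ∧ ∀ᶠ n in atTop,
      δ ≤ gammaMean c a (eulerOn J (fun i => cutoff (x i) n) i) := by
    intro i
    by_cases hi : i ∈ J
    · simp only [eulerOn, if_pos hi]
      exact eventually_le_gammaMean_X_mul_derivative_cutoff ha hc (hx i)
    · simp only [eulerOn, if_neg hi]
      exact eventually_le_gammaMean_cutoff ha hc (hx i)
  choose δ hδ hle using h
  exact ⟨∏ i, δ i, Finset.prod_pos fun i _ => hδ i, (eventually_all.2 hle).mono fun n hn =>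
    Finset.prod_le_prod (fun i _ => (hδ i).le) fun i _ => hn i⟩

end Cutoff

section MonotonePath

open Polynomial

variable {m n : Type} [Fintype m] [DecidableEq m] [Fintype n] [DecidableEq n]
  {A : Matrix m m ℝ} {B : Matrix m n ℝ} {D : Matrix n n ℝ}

theorem exists_polyFunctional_scaledBlocks_gap (h : (fromBlocks A B Bᵀ D).PosDef) {i₀ : m} {j₀ : n}
    (hB : B i₀ j₀ ≠ 0) {α : ℝ} (hα : 0 < α) (hN : (∃ n : ℕ, 2 * (α + 1) = n) ∨
      (Fintype.card (m ⊕ n) : ℝ) ≤ 2 * (2 * (α + 1))) :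
    ∃ c κ : ℝ, 0 < c ∧ 0 < κ ∧ ∀ (d : ℕ) (q : m ⊕ n → ℝ[X]), (∀ i, (q i).natDegree < d) →
      (∀ i, ∀ s ∈ Set.Icc (0 : ℝ) 1, 0 ≤ (q i).eval s) →
      (∀ i, ∀ s ∈ Set.Icc (0 : ℝ) 1, 0 ≤ (derivative (q i)).eval s) →
      polyFunctional d q (fun t => (1 + scaledBlocks A B D 0 * diagonal t).det ^ (-α)) +
          κ * ∏ i, gammaMean c (α + 1) (eulerOn {Sum.inl i₀, Sum.inr j₀} q i) ≤
        polyFunctional d q (fun t => (1 + fromBlocks A B Bᵀ D * diagonal t).det ^ (-α)) := by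
  obtain ⟨c, hc, hcS⟩ := exists_pos_smul_sub_one_posDef h
  have hcS' : ∀ τ ∈ Set.Icc (0 : ℝ) 1, (c • scaledBlocks A B D τ - 1).PosDef := by
    intro τ hτ
    rw [smul_scaledBlocks_sub_one]
    refine scaledBlocks_posDef ?_ hτ
    rwa [← scaledBlocks_one, smul_scaledBlocks_sub_one, scaledBlocks_one] at hcS
  have hS : ∀ τ ∈ Set.Icc (0 : ℝ) 1, (scaledBlocks A B D τ).PosDef := fun τ hτ =>
    scaledBlocks_posDef h hτ
  set K : ℝ := (c • scaledBlocks A B D 0).det ^ (-(α + 1)) with hK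
  have hcdet : ∀ τ ∈ Set.Icc (0 : ℝ) 1, 0 < (c • scaledBlocks A B D τ).det := fun τ hτ =>
    ((hS τ hτ).smul hc).det_pos
  have h01 : (0 : ℝ) ∈ Set.Icc (0 : ℝ) 1 := ⟨le_rfl, zero_le_one⟩
  have h11 : (1 : ℝ) ∈ Set.Icc (0 : ℝ) 1 := ⟨zero_le_one, le_rfl⟩
  have hKpos : 0 < K := Real.rpow_pos_of_pos (hcdet 0 h01) _
  have hKle : ∀ τ ∈ Set.Icc (0 : ℝ) 1, K ≤ (c • scaledBlocks A B D τ).det ^ (-(α + 1)) := by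
    intro τ hτ
    refine Real.rpow_le_rpow_of_nonpos (hcdet τ hτ) ?_ (by linarith)
    rw [det_smul, det_smul]
    exact mul_le_mul_of_nonneg_left (det_scaledBlocks_antitoneOn h h01 hτ hτ.1) (by positivity)
  refine ⟨c, α * K * B i₀ j₀ ^ 2, hc, by positivity, fun d q hd hq hq' => ?_⟩
  set J₀ : Finset (m ⊕ n) := {Sum.inl i₀, Sum.inr j₀} with hJ₀
  have hmean : ∀ J, 0 ≤ ∏ i, gammaMean c (α + 1) (eulerOn J q i) := fun J =>
    Finset.prod_nonneg fun i _ => gammaMean_nonneg _ _ (eulerOn_eval_nonneg hq hq' J i)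
  set P := ∏ i, gammaMean c (α + 1) (eulerOn J₀ q i) with hP
  let m' : Finset (m ⊕ n) → ℝ → ℝ := fun J τ => principalMinor (scaledBlocks A B D τ) J
  have hdiff : ∀ J, Differentiable ℝ (m' J) := fun J => differentiable_principalMinor_scaledBlocks J
  have hderiv : ∀ J, ∀ τ ∈ Set.Ioo (0 : ℝ) 1, deriv (m' J) τ ≤ 0 := by
    intro J τ hτ
    rw [← derivWithin_of_mem_nhds (Icc_mem_nhds hτ.1 hτ.2)]
    exact (principalMinor_scaledBlocks_antitoneOn h J).derivWithin_nonpos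
  let F : (m ⊕ n → ℝ) → ℝ → ℝ := fun t τ => (1 + scaledBlocks A B D τ * diagonal t).det
  have hFpos : ∀ t : m ⊕ n → ℝ, (∀ i, 0 ≤ t i) → ∀ τ ∈ Set.Icc (0 : ℝ) 1, 0 < F t τ :=
    fun t ht τ hτ => one_pos.trans_le (det_one_add_mul_diagonal_pos (hS τ hτ).posSemidef ht)
  have hFderiv : ∀ t τ, HasDerivAt (F t) (∑ J, deriv (m' J) τ * ∏ j ∈ J, t j) τ := by
    intro t τ
    have : F t = fun τ => ∑ J, m' J τ * ∏ j ∈ J, t j := by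
      ext τ
      exact det_one_add_mul_diagonal_eq_sum _ _
    rw [this]
    exact HasDerivAt.fun_sum fun J _ => ((hdiff J τ).hasDerivAt).mul_const _
  let g : ℝ → ℝ := fun τ => polyFunctional d q fun t => F t τ ^ (-α)
  have hg : ∀ τ ∈ Set.Icc (0 : ℝ) 1, HasDerivAt g (∑ J, -α * deriv (m' J) τ *
      polyFunctional d (eulerOn J q) fun t => F t τ ^ (-(α + 1))) τ := by
    intro τ hτ
    have h1 : HasDerivAt g (∑ k : m ⊕ n → Fin d, (∏ i, (q i).coeff (k i)) *
        ((∑ J, deriv (m' J) τ * ∏ j ∈ J, ((k j : ℕ) : ℝ)) * (-α) *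
          F (fun i => ((k i : ℕ) : ℝ)) τ ^ (-α - 1))) τ :=
      HasDerivAt.fun_sum fun k _ => (((hFderiv _ τ).rpow_const
        (Or.inl (hFpos _ (fun i => Nat.cast_nonneg _) τ hτ).ne')).const_mul _)
    convert h1 using 1
    simp_rw [← polyFunctional_prod_mul, polyFunctional, Finset.mul_sum, Finset.sum_mul,
      Finset.mul_sum]
    rw [Finset.sum_comm]
    refine Finset.sum_congr rfl fun k _ => Finset.sum_congr rfl fun J _ => ?_
    rw [neg_add']
    ring
  have hmono : MonotoneOn (fun τ => g τ + α * P * K * m' J₀ τ) (Set.Icc 0 1) := by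
    have hd' : ∀ τ ∈ Set.Icc (0 : ℝ) 1, HasDerivAt (fun τ => g τ + α * P * K * m' J₀ τ) _ τ :=
      fun τ hτ => (hg τ hτ).add (((hdiff J₀ τ).hasDerivAt).const_mul (α * P * K))
    refine monotoneOn_of_deriv_nonneg (convex_Icc 0 1)
      (fun τ hτ => (hd' τ hτ).continuousAt.continuousWithinAt) (fun τ hτ =>
        (hd' τ (interior_subset hτ)).differentiableAt.differentiableWithinAt) fun τ hτ => ?_
    have hτ' := interior_subset hτ
    rw [interior_Icc] at hτ
    rw [(hd' τ hτ').deriv]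
    have hlow : ∀ J, K * ∏ i, gammaMean c (α + 1) (eulerOn J q i) ≤
        polyFunctional d (eulerOn J q) fun t => F t τ ^ (-(α + 1)) := fun J =>
      (mul_le_mul_of_nonneg_right (hKle τ hτ') (hmean J)).trans
        (le_polyFunctional_det_rpow (hS τ hτ').posSemidef hc (hcS' τ hτ') (by linarith) hN
          (natDegree_eulerOn_lt hd J) (eulerOn_eval_nonneg hq hq' J))
    have hterm : ∀ J, 0 ≤ -α * deriv (m' J) τ := fun J =>
      mul_nonneg_of_nonpos_of_nonpos (by linarith) (hderiv J τ hτ)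
    have h1 : -α * deriv (m' J₀) τ * (K * P) ≤ ∑ J, -α * deriv (m' J) τ *
        polyFunctional d (eulerOn J q) fun t => F t τ ^ (-(α + 1)) := by
      refine (mul_le_mul_of_nonneg_left (hlow J₀) (hterm J₀)).trans ?_
      exact Finset.single_le_sum (f := fun J => -α * deriv (m' J) τ *
        polyFunctional d (eulerOn J q) fun t => F t τ ^ (-(α + 1))) (fun J _ =>
        mul_nonneg (hterm J) ((mul_nonneg hKpos.le (hmean J)).trans (hlow J))) (Finset.mem_univ J₀)
    linarith
  have hfin := hmono h01 h11 zero_le_one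
  simp only [m', hJ₀, principalMinor_scaledBlocks_pair] at hfin
  rw [← scaledBlocks_one]
  change g 0 + _ ≤ g 1
  linarith

end MonotonePath

section BlockInequality

open Polynomial Filter Topology

theorem polyFunctional_congr {ι : Type} [Fintype ι] [DecidableEq ι] {d : ℕ} {q : ι → ℝ[X]}
    {f g : (ι → ℝ) → ℝ} (h : ∀ t, (∀ i, 0 ≤ t i) → f t = g t) :
    polyFunctional d q f = polyFunctional d q g :=
  Finset.sum_congr rfl fun k _ => by rw [h _ fun i => Nat.cast_nonneg _]

variable {m n : Type} [Fintype m] [DecidableEq m] [Fintype n] [DecidableEq n]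
  {A : Matrix m m ℝ} {B : Matrix m n ℝ} {D : Matrix n n ℝ}

theorem one_add_fromBlocks_mul_diagonal (A : Matrix m m ℝ) (B : Matrix m n ℝ) (C : Matrix n m ℝ)
    (D : Matrix n n ℝ) (a : m → ℝ) (b : n → ℝ) :
    1 + fromBlocks A B C D * diagonal (Sum.elim a b) = fromBlocks (1 + A * diagonal a)
      (B * diagonal b) (C * diagonal a) (1 + D * diagonal b) := by
  rw [← fromBlocks_diagonal, fromBlocks_multiply, ← fromBlocks_one, fromBlocks_add]
  simp

theorem det_one_add_scaledBlocks_zero (A : Matrix m m ℝ) (B : Matrix m n ℝ) (D : Matrix n n ℝ)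
    (a : m → ℝ) (b : n → ℝ) : (1 + scaledBlocks A B D 0 * diagonal (Sum.elim a b)).det =
      (1 + fromBlocks A B Bᵀ D * diagonal (Sum.elim a 0)).det *
        (1 + fromBlocks A B Bᵀ D * diagonal (Sum.elim 0 b)).det := by
  rw [scaledBlocks, one_add_fromBlocks_mul_diagonal, one_add_fromBlocks_mul_diagonal,
    one_add_fromBlocks_mul_diagonal]
  have h0 : diagonal (0 : m → ℝ) = 0 := diagonal_zero
  have h1 : diagonal (0 : n → ℝ) = 0 := diagonal_zero
  simp [h0, h1, det_fromBlocks_zero₂₁]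

theorem prod_measureReal_lt_of_laplace (h : (fromBlocks A B Bᵀ D).PosDef) (hB : B ≠ 0) {α : ℝ}
    (hα : 0 < α) (hN : (∃ n : ℕ, 2 * (α + 1) = n) ∨
      (Fintype.card (m ⊕ n) : ℝ) ≤ 2 * (2 * (α + 1)))
    (μ : Measure (m ⊕ n → ℝ)) [IsProbabilityMeasure μ] (hpos : ∀ᵐ x ∂μ, ∀ i, 0 ≤ x i)
    (hlt : ∀ t : m ⊕ n → ℝ, (∀ j, 0 ≤ t j) → ∫ x, Real.exp (-∑ j, t j * x j) ∂μ =
      (1 + fromBlocks A B Bᵀ D * diagonal t).det ^ (-α))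
    {x : m ⊕ n → ℝ} (hx : ∀ i, 0 < x i) :
    (μ.prod μ).real
        ((fun ω i => Sum.elim (fun j => ω.1 (Sum.inl j)) (fun j => ω.2 (Sum.inr j)) i) ⁻¹'
        Set.univ.pi fun i => Set.Icc 0 (x i)) <
      μ.real (Set.univ.pi fun i => Set.Icc 0 (x i)) := by
  obtain ⟨i₀, j₀, hij⟩ : ∃ i j, B i j ≠ 0 := by
    by_contra! hcon
    exact hB (Matrix.ext hcon)
  obtain ⟨c, κ, hc, hκ, hgap⟩ := exists_polyFunctional_scaledBlocks_gap h hij hα hN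
  set Y : (m ⊕ n → ℝ) × (m ⊕ n → ℝ) → m ⊕ n → ℝ := fun ω i =>
    Sum.elim (fun j => ω.1 (Sum.inl j)) (fun j => ω.2 (Sum.inr j)) i with hYdef
  have hY : Measurable Y := by
    refine measurable_pi_lambda _ fun i => ?_
    rcases i with i | i
    · exact (measurable_pi_apply _).comp measurable_fst
    · exact (measurable_pi_apply _).comp measurable_snd
  have hYpos : ∀ᵐ ω ∂(μ.prod μ), ∀ i, 0 ≤ Y ω i := by
    filter_upwards [Measure.quasiMeasurePreserving_fst.ae hpos,
      Measure.quasiMeasurePreserving_snd.ae hpos] with ω h1 h2 i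
    rcases i with i | i
    · exact h1 _
    · exact h2 _
  have hYlt : ∀ t : m ⊕ n → ℝ, (∀ j, 0 ≤ t j) →
      ∫ ω, Real.exp (-∑ j, t j * Y ω j) ∂(μ.prod μ) =
        (1 + scaledBlocks A B D 0 * diagonal t).det ^ (-α) := by
    intro t ht
    have h1 : ∀ i, 0 ≤ (Sum.elim (t ∘ Sum.inl) 0 : m ⊕ n → ℝ) i := by
      rintro (i | i)
      · exact ht _
      · exact le_rfl
    have h2 : ∀ i, 0 ≤ (Sum.elim 0 (t ∘ Sum.inr) : m ⊕ n → ℝ) i := by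
      rintro (i | i)
      · exact le_rfl
      · exact ht _
    have h3 := fun {s} hs => zero_le_one.trans
      (det_one_add_mul_diagonal_pos (t := s) h.posSemidef hs)
    rw [← Sum.elim_comp_inl_inr t, det_one_add_scaledBlocks_zero, Real.mul_rpow (h3 h1) (h3 h2),
      ← hlt _ h1, ← hlt _ h2, ← integral_prod_mul]
    refine integral_congr_ae (Eventually.of_forall fun ω => ?_)
    simp only [hYdef, Fintype.sum_sum_type, Sum.elim_inl, Sum.elim_inr, ← Real.exp_add,
      Function.comp_apply, Pi.zero_apply, zero_mul, Finset.sum_const_zero]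
    ring_nf
  obtain ⟨δ, hδ, hle⟩ := eventually_le_prod_gammaMean_eulerOn_cutoff (a := α + 1) (by linarith)
    hc hx {Sum.inl i₀, Sum.inr j₀}
  have hlim₁ := tendsto_integral_prod_cutoff hx (μ.prod μ) hY hYpos
  have hlim₂ := tendsto_integral_prod_cutoff hx μ (Y := id) measurable_id hpos
  have hfin := le_of_tendsto_of_tendsto (hlim₁.add_const (κ * δ)) hlim₂ <| hle.mono fun k hk => by
    let q : m ⊕ n → ℝ[X] := fun i => cutoff (x i) k
    let d := ∑ i, (q i).natDegree + 1
    have hd : ∀ i, (q i).natDegree < d := fun i => Nat.lt_succ_of_le <|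
      Finset.single_le_sum (f := fun i => (q i).natDegree) (fun _ _ => Nat.zero_le _)
        (Finset.mem_univ i)
    have h1 := hgap d q hd (fun i s hs => (cutoff_eval_mem_Icc (x i) k hs).1)
      fun i s hs => derivative_cutoff_eval_nonneg (x i) k hs
    rw [← polyFunctional_congr hYlt, ← polyFunctional_congr hlt,
      polyFunctional_laplace _ hY hYpos hd] at h1
    have h2 := polyFunctional_laplace μ (X := id) measurable_id hpos hd
    simp only [id] at h2
    rw [h2] at h1
    refine le_trans ?_ h1
    exact add_le_add le_rfl (mul_le_mul_of_nonneg_left hk hκ.le)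
  have : 0 < κ * δ := mul_pos hκ hδ
  rw [Set.preimage_id] at hfin
  linarith

end BlockInequality

/-- Extension of inequality (2.8): the cumulative distribution function of a
`Γ_p(α, Σ)` measure strictly dominates the product of the cdfs of its two
marginal blocks, for all `2α ∈ ℕ ∪ (⌊(p-1)/2⌋, ∞)`, whenever `Σ₁₂ ≠ 0`. -/
theorem gamma_correlation_inequality (p₁ p₂ : ℕ) (hp₁ : 1 ≤ p₁) (hp₂ : 1 ≤ p₂)
    (S₁₁ : Matrix (Fin p₁) (Fin p₁) ℝ) (S₁₂ : Matrix (Fin p₁) (Fin p₂) ℝ)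
    (S₂₂ : Matrix (Fin p₂) (Fin p₂) ℝ)
    (S : Matrix (Fin p₁ ⊕ Fin p₂) (Fin p₁ ⊕ Fin p₂) ℝ)
    (hS : S = Matrix.fromBlocks S₁₁ S₁₂ S₁₂ᵀ S₂₂)
    (hSpos : S.PosDef) (hS₁₂ : S₁₂ ≠ 0)
    (α : ℝ) (hα : 0 < α)
    (hcond : (∃ n : ℕ, 0 < n ∧ 2 * α = n) ∨ 2 * α > ((p₁ + p₂ - 1) / 2 : ℕ))
    (μ : Measure (Fin p₁ ⊕ Fin p₂ → ℝ)) (hprob : IsProbabilityMeasure μ)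
    (hsupp : μ {x | ∀ i, 0 ≤ x i}ᶜ = 0)
    (hlt : ∀ t : Fin p₁ ⊕ Fin p₂ → ℝ, (∀ j, 0 ≤ t j) →
      ∫ x, Real.exp (-∑ j, t j * x j) ∂μ = (1 + S * Matrix.diagonal t).det ^ (-α))
    (μ₁ : Measure (Fin p₁ → ℝ)) (hμ₁ : μ₁ = μ.map (fun x => x ∘ Sum.inl))
    (μ₂ : Measure (Fin p₂ → ℝ)) (hμ₂ : μ₂ = μ.map (fun x => x ∘ Sum.inr)) :
    ∀ x : Fin p₁ ⊕ Fin p₂ → ℝ, (∀ i, 0 < x i) →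
      μ₁ (Set.univ.pi fun i => Set.Icc 0 (x (Sum.inl i))) *
        μ₂ (Set.univ.pi fun i => Set.Icc 0 (x (Sum.inr i)))
        < μ (Set.univ.pi fun i => Set.Icc 0 (x i)) := by
  intro x hx
  have hpos : ∀ᵐ y ∂μ, ∀ i, 0 ≤ y i := hsupp
  have hN : (∃ n : ℕ, 2 * (α + 1) = n) ∨
      (Fintype.card (Fin p₁ ⊕ Fin p₂) : ℝ) ≤ 2 * (2 * (α + 1)) := by
    rcases hcond with ⟨n, _, hn⟩ | hlarge
    · exact Or.inl ⟨n + 2, by push_cast; linarith⟩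
    · right
      rw [Fintype.card_sum, Fintype.card_fin, Fintype.card_fin]
      have h1 : p₁ + p₂ ≤ 2 * ((p₁ + p₂ - 1) / 2) + 2 := by omega
      have h2 : ((p₁ + p₂ : ℕ) : ℝ) ≤ ((2 * ((p₁ + p₂ - 1) / 2) + 2 : ℕ) : ℝ) := Nat.cast_le.2 h1
      rw [Nat.cast_add (2 * _), Nat.cast_mul, Nat.cast_two] at h2
      linarith
  subst hS
  have hlt' := prod_measureReal_lt_of_laplace hSpos hS₁₂ hα hN μ hpos hlt hx
  rw [hμ₁, hμ₂, Measure.map_apply (by fun_prop) (MeasurableSet.univ_pi fun _ => measurableSet_Icc),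
    Measure.map_apply (by fun_prop) (MeasurableSet.univ_pi fun _ => measurableSet_Icc),
    ← Measure.prod_prod]
  convert (ENNReal.toReal_lt_toReal (measure_ne_top _ _) (measure_ne_top _ _)).1 hlt' using 2
  ext ω
  simp [Sum.forall, -Set.pi_univ_Icc]
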